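/- For every C > 0 and a > 0 there exists exactly one solution P = P_C of the fractional obstacle problem with obstacle Φ(y) = C − a|y|². Moreover P_C is radially symmetric as a function of y, and V_C := L_s P_C is Hölder continuous with exponent 1−s and has compact support. -/

import Mathlib

open MeasureTheory Real Set Filter
open scoped RealInnerProductSpace

noncomputable section

/-- Euclidean space ℝⁿ. -/
abbrev Spc (n : ℕ) := EuclideanSpace ℝ (Fin n)

/-- A normalizing constant for the fractional Laplacian `(−Δ)^s`. -/
def fracLapConst (n : ℕ) (s : ℝ) : ℝ :=
  4 ^ s * Real.Gamma ((n : ℝ) / 2 + s) / (Real.pi ^ ((n : ℝ) / 2) * |Real.Gamma (-s)|)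

/-- The fractional Laplacian `L_s = (−Δ)^s`, given by the symmetric singular integral
`(L_s p)(x) = (C(n,s)/2) ∫ (2p(x) − p(x+z) − p(x−z)) |z|^{−n−2s} dz`. -/
def Ls (n : ℕ) (s : ℝ) (p : Spc n → ℝ) (x : Spc n) : ℝ :=
  (fracLapConst n s / 2) *
    ∫ z : Spc n, (2 * p x - p (x + z) - p (x - z)) * ‖z‖ ^ (-(n : ℝ) - 2 * s)

/-- `p` is `C¹` with locally `s`-Hölder continuous gradient (class `C^{1,s}`). -/
def C1HolderGrad (n : ℕ) (s : ℝ) (p : Spc n → ℝ) : Prop :=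
  ContDiff ℝ 1 p ∧
  ∀ K : Set (Spc n), IsCompact K → ∃ M : ℝ, ∀ x ∈ K, ∀ y ∈ K,
    ‖gradient p x - gradient p y‖ ≤ M * ‖x - y‖ ^ s

/-- Solution of the fractional obstacle problem with obstacle `Φ(y) = C − a|y|²`:
`P` of class `C^{1,s}` with `P → 0` at infinity, `P ≥ Φ`, `V = L_s P` continuous and
nonnegative, and at every point either `P = Φ` or `V = 0`. -/
def IsObstacleSol (n : ℕ) (s : ℝ) (C a : ℝ) (P : Spc n → ℝ) : Prop :=
  C1HolderGrad n s P ∧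
  Filter.Tendsto P (Filter.cocompact (Spc n)) (nhds 0) ∧
  (∀ y : Spc n, C - a * ‖y‖ ^ 2 ≤ P y) ∧
  Continuous (Ls n s P) ∧
  (∀ y : Spc n, 0 ≤ Ls n s P y) ∧
  (∀ y : Spc n, P y = C - a * ‖y‖ ^ 2 ∨ Ls n s P y = 0)

/-- The angular interval `(-π/2, π/2)`. -/
abbrev angles : Set ℝ := Ioo (-(π / 2)) (π / 2)

lemma cos_pos_angles {θ : ℝ} (h : θ ∈ angles) : 0 < cos θ := cos_pos_of_mem_Ioo h

lemma integrableOn_cos_rpow {p : ℝ} (hp : -1 < p) :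
    IntegrableOn (fun θ => cos θ ^ p) angles := by
  have hpi := Real.pi_pos
  have hpow : IntervalIntegrable (fun x : ℝ => x ^ p) volume 0 1 :=
    intervalIntegral.intervalIntegrable_rpow' hp
  have h1 : IntervalIntegrable (fun x : ℝ => (1 - 2 / π * x) ^ p) volume 0 (π / 2) := by
    have := (hpow.symm.comp_sub_left 1).comp_mul_left (c := 2 / π)
    simp only [sub_self, sub_zero] at this
    convert this using 1 <;> field_simp
    simp
  have h2 : IntervalIntegrable (fun x : ℝ => (1 + 2 / π * x) ^ p) volume (-(π / 2)) 0 := by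
    have := h1.symm.comp_sub_left 0
    simpa using this
  have m : AEStronglyMeasurable (fun θ : ℝ => cos θ ^ p) volume :=
    (Real.continuous_cos.measurable.pow_const p).aestronglyMeasurable
  rw [intervalIntegrable_iff_integrableOn_Ioo_of_le (by positivity)] at h1
  rw [intervalIntegrable_iff_integrableOn_Ioo_of_le (by linarith)] at h2
  rcases le_or_gt 0 p with h0 | h0
  · refine Measure.integrableOn_of_bounded (M := 1) (by simp) m ?_
    filter_upwards [ae_restrict_mem measurableSet_Ioo] with θ hθ
    have hc := (cos_pos_angles hθ).le
    rw [Real.norm_of_nonneg (by positivity)]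
    exact rpow_le_one hc (cos_le_one θ) h0
  · have e : Ioo (-(π / 2)) (π / 2) ⊆ (Ioo (-(π / 2)) 0 ∪ Ioo 0 (π / 2)) ∪ {0} := by
      intro x hx
      rcases lt_trichotomy x 0 with h | h | h
      · exact Or.inl (Or.inl ⟨hx.1, h⟩)
      · exact Or.inr h
      · exact Or.inl (Or.inr ⟨h, hx.2⟩)
    refine IntegrableOn.mono_set (IntegrableOn.union (IntegrableOn.union ?_ ?_) ?_) e
    · refine h2.mono' m.restrict ?_
      filter_upwards [ae_restrict_mem measurableSet_Ioo] with θ hθ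
      have hc : 0 < cos θ := cos_pos_angles ⟨hθ.1, by linarith [hθ.2]⟩
      rw [Real.norm_of_nonneg (by positivity)]
      have := one_add_mul_le_cos hθ.1.le hθ.2.le
      refine rpow_le_rpow_of_nonpos ?_ this h0.le
      have h3 := hθ.1
      have : 2 / π * -(π / 2) < 2 / π * θ := by gcongr
      field_simp at this ⊢
      linarith
    · refine h1.mono' m.restrict ?_
      filter_upwards [ae_restrict_mem measurableSet_Ioo] with θ hθ
      have hc : 0 < cos θ := cos_pos_angles ⟨by linarith [hθ.1], hθ.2⟩
      rw [Real.norm_of_nonneg (by positivity)]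
      have := one_sub_mul_le_cos hθ.1.le hθ.2.le
      refine rpow_le_rpow_of_nonpos ?_ this h0.le
      have h3 := hθ.2
      have : 2 / π * θ < 2 / π * (π / 2) := by gcongr
      field_simp at this ⊢
      linarith
    · simp

/-- The base `e^{-iθ} + e^{iθ} u` of the complex bubbles. -/
def bub (θ u : ℝ) : ℂ := Complex.exp (-(θ * Complex.I)) + Complex.exp (θ * Complex.I) * u

lemma bub_re (θ u : ℝ) : (bub θ u).re = cos θ * (1 + u) := by
  simp [bub, Complex.exp_re, Complex.exp_im]
  ring

lemma bub_im (θ u : ℝ) : (bub θ u).im = sin θ * (u - 1) := by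
  simp [bub, Complex.exp_re, Complex.exp_im]
  ring

lemma cos_mul_le_norm_bub (θ u : ℝ) : cos θ * (1 + u) ≤ ‖bub θ u‖ := by
  rw [← bub_re]; exact Complex.re_le_norm _

lemma bub_re_pos {θ u : ℝ} (hθ : θ ∈ angles) (hu : -1 < u) : 0 < (bub θ u).re := by
  rw [bub_re]; exact mul_pos (cos_pos_angles hθ) (by linarith)

lemma bub_mem_slitPlane {θ u : ℝ} (hθ : θ ∈ angles) (hu : -1 < u) :
    bub θ u ∈ Complex.slitPlane := Or.inl (bub_re_pos hθ hu)

lemma bub_mem_slitPlane_of_ne_one {θ u : ℝ} (hθ : θ ∈ Icc (-(π / 2)) (π / 2)) (hu : -1 < u)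
    (hu1 : u ≠ 1) : bub θ u ∈ Complex.slitPlane := by
  have hc := cos_nonneg_of_mem_Icc hθ
  rcases hc.lt_or_eq with h | h
  · left; rw [bub_re]; exact mul_pos h (by linarith)
  · right
    rw [bub_im]
    refine mul_ne_zero ?_ (sub_ne_zero.2 hu1)
    intro h0
    have := sin_sq_add_cos_sq θ
    rw [h0, ← h] at this
    norm_num at this

lemma le_norm_bub {θ u δ : ℝ} (hδ : 0 ≤ δ) (h1 : δ ≤ 1 + u) (h2 : δ ≤ |u - 1|) :
    δ ≤ ‖bub θ u‖ := by
  have hsq : δ ^ 2 ≤ ‖bub θ u‖ ^ 2 := by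
    rw [Complex.sq_norm, Complex.normSq_apply, bub_re, bub_im]
    have e1 : δ ^ 2 ≤ (1 + u) ^ 2 := by gcongr
    have e2 : δ ^ 2 ≤ (u - 1) ^ 2 := by rw [← sq_abs (u - 1)]; gcongr
    have e3 := sin_sq_add_cos_sq θ
    nlinarith [mul_nonneg (sq_nonneg (cos θ)) (sub_nonneg.2 e1),
      mul_nonneg (sq_nonneg (sin θ)) (sub_nonneg.2 e2)]
  exact (sq_le_sq₀ hδ (norm_nonneg _)).1 hsq

lemma continuous_bub (u : ℝ) : Continuous (fun θ => bub θ u) := by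
  unfold bub; fun_prop

/-- The integrand of `bubInt`. -/
def bubFun (d m γ u θ : ℝ) : ℂ :=
  (((2 * cos θ) ^ d : ℝ) : ℂ) * Complex.exp (m * θ * Complex.I) * bub θ u ^ (-γ : ℂ)

/-- The angular superposition of complex bubbles. -/
def bubInt (d m γ u : ℝ) : ℂ := ∫ θ in angles, bubFun d m γ u θ

lemma norm_bubFun {d m γ u θ : ℝ} (hθ : θ ∈ angles) :
    ‖bubFun d m γ u θ‖ = (2 * cos θ) ^ d * ‖bub θ u‖ ^ (-γ) := by
  have hc := cos_pos_angles hθ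
  rw [bubFun, norm_mul, norm_mul, ← Complex.ofReal_neg, Complex.norm_cpow_real,
    ← Complex.ofReal_mul, Complex.norm_exp_ofReal_mul_I, Complex.norm_real,
    Real.norm_of_nonneg (by positivity), mul_one]

lemma measurable_bubFun (d m γ u : ℝ) : Measurable (bubFun d m γ u) := by
  have := (continuous_bub u).measurable
  unfold bubFun
  fun_prop

lemma norm_bubFun_le {d m γ u θ : ℝ} (hγ : 0 ≤ γ) (hθ : θ ∈ angles) (hu : -1 < u) :
    ‖bubFun d m γ u θ‖ ≤ 2 ^ d * cos θ ^ (d - γ) * (1 + u) ^ (-γ) := by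
  have hc := cos_pos_angles hθ
  have hu' : 0 < 1 + u := by linarith
  have e : 2 ^ d * cos θ ^ (d - γ) * (1 + u) ^ (-γ)
      = (2 * cos θ) ^ d * (cos θ * (1 + u)) ^ (-γ) := by
    rw [mul_rpow (by norm_num) hc.le, sub_eq_add_neg, rpow_add hc, mul_rpow hc.le hu'.le]
    ring
  rw [norm_bubFun hθ, e]
  refine mul_le_mul_of_nonneg_left ?_ (by positivity)
  exact rpow_le_rpow_of_nonpos (by positivity) (cos_mul_le_norm_bub θ u) (by linarith)

lemma norm_bubFun_le' {d m γ u θ δ : ℝ} (hd : 0 ≤ d) (hγ : 0 ≤ γ) (hθ : θ ∈ angles) (hδ : 0 < δ)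
    (h1 : δ ≤ 1 + u) (h2 : δ ≤ |u - 1|) :
    ‖bubFun d m γ u θ‖ ≤ 2 ^ d * δ ^ (-γ) := by
  have hc := cos_pos_angles hθ
  rw [norm_bubFun hθ, mul_rpow (by norm_num) hc.le, mul_assoc]
  have : cos θ ^ d ≤ 1 := rpow_le_one hc.le (cos_le_one θ) hd
  have h3 : ‖bub θ u‖ ^ (-γ) ≤ δ ^ (-γ) :=
    rpow_le_rpow_of_nonpos hδ (le_norm_bub hδ.le h1 h2) (by linarith)
  gcongr
  calc _ ≤ 1 * δ ^ (-γ) := by gcongr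
    _ = _ := one_mul _

lemma hasDerivAt_bub_cpow {γ : ℂ} {θ u : ℝ} (h : bub θ u ∈ Complex.slitPlane) :
    HasDerivAt (fun u => bub θ u ^ γ)
      (γ * bub θ u ^ (γ - 1) * Complex.exp (θ * Complex.I)) u := by
  have h0 : HasDerivAt (fun w : ℂ => Complex.exp (-(θ * Complex.I)) +
      Complex.exp (θ * Complex.I) * w) (Complex.exp (θ * Complex.I)) (u : ℂ) := by
    simpa using ((hasDerivAt_id (u : ℂ)).const_mul (Complex.exp (θ * Complex.I))).const_add
      (Complex.exp (-(θ * Complex.I)))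
  exact (h0.cpow_const (c := γ) h).comp_ofReal

lemma hasDerivAt_bubFun {d m γ u θ : ℝ} (hθ : θ ∈ angles) (hu : -1 < u) :
    HasDerivAt (fun u => bubFun d m γ u θ) (-γ * bubFun d (m + 1) (γ + 1) u θ) u := by
  have h := (hasDerivAt_bub_cpow (γ := -γ) (bub_mem_slitPlane hθ hu)).const_mul
    ((((2 * cos θ) ^ d : ℝ) : ℂ) * Complex.exp (m * θ * Complex.I))
  refine HasDerivAt.congr_deriv (f := fun u => bubFun d m γ u θ) h ?_
  have e : Complex.exp (((m + 1 : ℝ) : ℂ) * θ * Complex.I)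
      = Complex.exp (m * θ * Complex.I) * Complex.exp (θ * Complex.I) := by
    rw [← Complex.exp_add]; push_cast; ring_nf
  have e2 : (-((γ + 1 : ℝ) : ℂ)) = -γ - 1 := by push_cast; ring
  simp only [bubFun]
  rw [e, e2]
  ring

lemma integrable_bubFun {d m γ u : ℝ} (hγ : 0 ≤ γ) (hγd : γ < d + 1) (hu : -1 < u) :
    IntegrableOn (bubFun d m γ u) angles := by
  have h := ((integrableOn_cos_rpow (p := d - γ) (by linarith)).const_mul (2 ^ d)).mul_const
    ((1 + u) ^ (-γ))
  refine h.mono' (measurable_bubFun d m γ u).aestronglyMeasurable ?_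
  filter_upwards [ae_restrict_mem measurableSet_Ioo] with θ hθ
  exact norm_bubFun_le hγ hθ hu

lemma integrable_bubFun' {d m γ u : ℝ} (hd : 0 ≤ d) (hγ : 0 ≤ γ) (hu : -1 < u) (hu1 : u ≠ 1) :
    IntegrableOn (bubFun d m γ u) angles := by
  have hδ : 0 < min (1 + u) |u - 1| := lt_min (by linarith) (abs_pos.2 (sub_ne_zero.2 hu1))
  refine Measure.integrableOn_of_bounded (M := 2 ^ d * (min (1 + u) |u - 1|) ^ (-γ)) (by simp)
    (measurable_bubFun d m γ u).aestronglyMeasurable ?_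
  filter_upwards [ae_restrict_mem measurableSet_Ioo] with θ hθ
  exact norm_bubFun_le' hd hγ hθ hδ (min_le_left _ _) (min_le_right _ _)

lemma exists_norm_bubInt_le {d γ : ℝ} (m : ℝ) (hγ : 0 ≤ γ) (hγd : γ < d + 1) :
    ∃ M, ∀ u, -1 < u → ‖bubInt d m γ u‖ ≤ M * (1 + u) ^ (-γ) := by
  refine ⟨∫ θ in angles, 2 ^ d * cos θ ^ (d - γ), fun u hu => ?_⟩
  rw [bubInt, ← integral_mul_const]
  refine norm_integral_le_of_norm_le
    (((integrableOn_cos_rpow (by linarith)).const_mul (2 ^ d)).mul_const _) ?_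
  filter_upwards [ae_restrict_mem measurableSet_Ioo] with θ hθ
  exact norm_bubFun_le hγ hθ hu

lemma continuousAt_bubInt {d m γ u : ℝ} (hγ : 0 ≤ γ) (hγd : γ < d + 1) (hu : -1 < u) :
    ContinuousAt (bubInt d m γ) u := by
  have hmid : -1 < (u - 1) / 2 := by linarith
  have hev : ∀ᶠ v in nhds u, (u - 1) / 2 < v := lt_mem_nhds (by linarith)
  refine continuousAt_of_dominated
    (bound := fun θ => 2 ^ d * cos θ ^ (d - γ) * (1 + (u - 1) / 2) ^ (-γ)) ?_ ?_ ?_ ?_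
  · exact Eventually.of_forall fun v => (measurable_bubFun d m γ v).aestronglyMeasurable
  · filter_upwards [hev] with v hv
    filter_upwards [ae_restrict_mem measurableSet_Ioo] with θ hθ
    have hc := cos_pos_angles hθ
    refine (norm_bubFun_le hγ hθ (by linarith)).trans ?_
    refine mul_le_mul_of_nonneg_left ?_ (by positivity)
    exact rpow_le_rpow_of_nonpos (by linarith) (by linarith) (by linarith)
  · exact ((integrableOn_cos_rpow (by linarith)).const_mul (2 ^ d)).mul_const _
  · filter_upwards [ae_restrict_mem measurableSet_Ioo] with θ hθ
    exact (hasDerivAt_bubFun hθ hu).continuousAt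

lemma hasDerivAt_bubInt {d m γ u : ℝ} (hγ : 0 ≤ γ) (hγd : γ < d) (hu : -1 < u) :
    HasDerivAt (bubInt d m γ) (-γ * bubInt d (m + 1) (γ + 1) u) u := by
  have hmid : -1 < (u - 1) / 2 := by linarith
  rw [bubInt, ← integral_const_mul]
  refine (hasDerivAt_integral_of_dominated_loc_of_deriv_le (s := Ioi ((u - 1) / 2))
    (F := fun v θ => bubFun d m γ v θ) (F' := fun v θ => -γ * bubFun d (m + 1) (γ + 1) v θ)
    (bound := fun θ => γ * (2 ^ d * cos θ ^ (d - (γ + 1)) * (1 + (u - 1) / 2) ^ (-(γ + 1))))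
    (Ioi_mem_nhds (by linarith)) ?_ ?_ ?_ ?_ ?_ ?_).2
  · exact Eventually.of_forall fun v => (measurable_bubFun d m γ v).aestronglyMeasurable
  · exact integrable_bubFun hγ (by linarith) hu
  · exact ((measurable_bubFun d (m + 1) (γ + 1) u).const_mul _).aestronglyMeasurable
  · filter_upwards [ae_restrict_mem measurableSet_Ioo] with θ hθ v hv
    have hc := cos_pos_angles hθ
    have hv : (u - 1) / 2 < v := hv
    rw [norm_mul, norm_neg, Complex.norm_real, Real.norm_of_nonneg hγ]
    refine mul_le_mul_of_nonneg_left ?_ hγ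
    refine (norm_bubFun_le (by linarith) hθ (by linarith)).trans ?_
    refine mul_le_mul_of_nonneg_left ?_ (by positivity)
    exact rpow_le_rpow_of_nonpos (by linarith) (by linarith) (by linarith)
  · exact (((integrableOn_cos_rpow (by linarith)).const_mul (2 ^ d)).mul_const _).const_mul _
  · filter_upwards [ae_restrict_mem measurableSet_Ioo] with θ hθ v hv
    have hv : (u - 1) / 2 < v := hv
    exact hasDerivAt_bubFun hθ (by linarith)

lemma hasDerivAt_bubInt_of_ne_one {d m γ u : ℝ} (hd : 0 ≤ d) (hγ : 0 ≤ γ) (hu : -1 < u)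
    (hu1 : u ≠ 1) : HasDerivAt (bubInt d m γ) (-γ * bubInt d (m + 1) (γ + 1) u) u := by
  set δ := min (1 + u) |u - 1| / 2 with hδdef
  have hδ : 0 < δ := half_pos (lt_min (by linarith) (abs_pos.2 (sub_ne_zero.2 hu1)))
  have key : ∀ v ∈ Metric.ball u δ, δ ≤ 1 + v ∧ δ ≤ |v - 1| := by
    intro v hv
    rw [Metric.mem_ball, Real.dist_eq] at hv
    have a1 : 2 * δ ≤ 1 + u := by rw [hδdef]; linarith [min_le_left (1 + u) |u - 1|]
    have a2 : 2 * δ ≤ |u - 1| := by rw [hδdef]; linarith [min_le_right (1 + u) |u - 1|]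
    have a3 := abs_sub_abs_le_abs_sub (u - 1) (v - 1)
    have a4 : |u - 1 - (v - 1)| = |v - u| := by rw [abs_sub_comm]; ring_nf
    constructor
    · linarith [(abs_lt.1 hv).1]
    · linarith
  rw [bubInt, ← integral_const_mul]
  refine (hasDerivAt_integral_of_dominated_loc_of_deriv_le (s := Metric.ball u δ)
    (F := fun v θ => bubFun d m γ v θ) (F' := fun v θ => -γ * bubFun d (m + 1) (γ + 1) v θ)
    (bound := fun θ => γ * (2 ^ d * δ ^ (-(γ + 1))))
    (Metric.ball_mem_nhds _ hδ) ?_ ?_ ?_ ?_ ?_ ?_).2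
  · exact Eventually.of_forall fun v => (measurable_bubFun d m γ v).aestronglyMeasurable
  · exact integrable_bubFun' hd hγ hu hu1
  · exact ((measurable_bubFun d (m + 1) (γ + 1) u).const_mul _).aestronglyMeasurable
  · filter_upwards [ae_restrict_mem measurableSet_Ioo] with θ hθ v hv
    rw [norm_mul, norm_neg, Complex.norm_real, Real.norm_of_nonneg hγ]
    exact mul_le_mul_of_nonneg_left
      (norm_bubFun_le' hd (by linarith) hθ hδ (key v hv).1 (key v hv).2) hγ
  · exact integrableOn_const (by simp)
  · filter_upwards [ae_restrict_mem measurableSet_Ioo] with θ hθ v hv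
    exact hasDerivAt_bubFun hθ (by linarith [(key v hv).1])

lemma hasDerivAt_bub_angle_cpow {γ : ℂ} {θ u : ℝ} (hb : bub θ u ∈ Complex.slitPlane) :
    HasDerivAt (fun θ => bub θ u ^ γ) (γ * bub θ u ^ (γ - 1) *
      (Complex.I * (Complex.exp (θ * Complex.I) * u - Complex.exp (-(θ * Complex.I))))) θ := by
  have h1 : HasDerivAt (fun w : ℂ => w * Complex.I) Complex.I (θ : ℂ) := by
    simpa using (hasDerivAt_id (θ : ℂ)).mul_const Complex.I
  have h2 : HasDerivAt (fun w : ℂ => Complex.exp (-(w * Complex.I)) +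
      Complex.exp (w * Complex.I) * u)
      (Complex.I * (Complex.exp (θ * Complex.I) * u - Complex.exp (-(θ * Complex.I))))
      (θ : ℂ) := (h1.neg.cexp.add (h1.cexp.mul_const _)).congr_deriv (by
        simp only [Pi.neg_apply]; ring)
  exact (h2.cpow_const (c := γ) hb).comp_ofReal

lemma exp_add_exp_neg_mul_I (θ : ℝ) :
    Complex.exp (θ * Complex.I) + Complex.exp (-(θ * Complex.I)) = ((2 * cos θ : ℝ) : ℂ) := by
  push_cast
  rw [Complex.cos, neg_mul]
  ring

lemma exp_sub_exp_neg_mul_I (θ : ℝ) :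
    Complex.I * (Complex.exp (θ * Complex.I) - Complex.exp (-(θ * Complex.I)))
      = ((-(2 * sin θ) : ℝ) : ℂ) := by
  push_cast
  rw [Complex.sin, neg_mul]
  ring

/-- The bracket in the angular derivative of `(2 cos θ)^{d+1} e^{ikθ} b^{-γ}`. -/
lemma hasDerivAt_angle {d k γ u θ : ℝ} (hd : 0 ≤ d) (hθ : θ ∈ Icc (-(π / 2)) (π / 2)) (hu : -1 < u)
    (hu1 : u ≠ 1) :
    HasDerivAt (fun θ : ℝ => (((2 * cos θ) ^ (d + 1) : ℝ) : ℂ) *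
        Complex.exp (k * θ * Complex.I) * bub θ u ^ (-γ : ℂ))
      (Complex.I * ((((2 * cos θ) ^ d : ℝ) : ℂ) * Complex.exp (k * θ * Complex.I) *
        bub θ u ^ (-γ - 1 : ℂ) *
        ((d + 1) * (Complex.exp (θ * Complex.I) - Complex.exp (-(θ * Complex.I))) * bub θ u
          + k * (Complex.exp (θ * Complex.I) + Complex.exp (-(θ * Complex.I))) * bub θ u
          - γ * (Complex.exp (θ * Complex.I) + Complex.exp (-(θ * Complex.I))) *
            (Complex.exp (θ * Complex.I) * u - Complex.exp (-(θ * Complex.I)))))) θ := by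
  have hb := bub_mem_slitPlane_of_ne_one hθ hu hu1
  have hb0 := Complex.slitPlane_ne_zero hb
  have hc := cos_nonneg_of_mem_Icc hθ
  have h1 : HasDerivAt (fun θ : ℝ => (((2 * cos θ) ^ (d + 1) : ℝ) : ℂ))
      (((2 * -sin θ) * (d + 1) * (2 * cos θ) ^ (d + 1 - 1) : ℝ) : ℂ) θ :=
    ((((hasDerivAt_cos θ).const_mul 2).rpow_const (p := d + 1) (Or.inr (by linarith)))).ofReal_comp
  have h2 : HasDerivAt (fun θ : ℝ => Complex.exp (k * θ * Complex.I))
      (Complex.exp (k * θ * Complex.I) * (k * Complex.I)) θ := by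
    have : HasDerivAt (fun w : ℂ => Complex.exp (k * w * Complex.I))
        (Complex.exp (k * θ * Complex.I) * (k * 1 * Complex.I)) (θ : ℂ) :=
      (((hasDerivAt_id (θ : ℂ)).const_mul (k : ℂ)).mul_const Complex.I).cexp
    simpa using this.comp_ofReal
  have h3 : HasDerivAt (fun θ : ℝ => bub θ u ^ (-γ : ℂ))
      (-γ * bub θ u ^ (-γ - 1 : ℂ) *
        (Complex.I * (Complex.exp (θ * Complex.I) * u - Complex.exp (-(θ * Complex.I))))) θ :=
    hasDerivAt_bub_angle_cpow hb
  refine ((h1.mul h2).mul h3).congr_deriv ?_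
  have e1 : bub θ u ^ (-γ : ℂ) = bub θ u ^ (-γ - 1 : ℂ) * bub θ u := by
    rw [Complex.cpow_sub _ _ hb0, Complex.cpow_one]; field_simp
  have e2 : (((2 * cos θ) ^ (d + 1) : ℝ) : ℂ) = (((2 * cos θ) ^ d : ℝ) : ℂ) *
      (Complex.exp (θ * Complex.I) + Complex.exp (-(θ * Complex.I))) := by
    rw [exp_add_exp_neg_mul_I, ← Complex.ofReal_mul, rpow_add_one' (by positivity) (by linarith)]
  have e3 : (((2 * -sin θ) * (d + 1) * (2 * cos θ) ^ (d + 1 - 1) : ℝ) : ℂ)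
      = (Complex.I * (Complex.exp (θ * Complex.I) - Complex.exp (-(θ * Complex.I)))) * (d + 1) *
        (((2 * cos θ) ^ d : ℝ) : ℂ) := by
    rw [exp_sub_exp_neg_mul_I, add_sub_cancel_right]; push_cast; ring
  simp only [Pi.mul_apply]
  rw [e1, e2, e3]
  ring

lemma integral_angle_eq_zero {d k γ u : ℝ} (hd : 0 ≤ d) (hu : -1 < u) (hu1 : u ≠ 1) :
    ∫ θ in angles, ((((2 * cos θ) ^ d : ℝ) : ℂ) * Complex.exp (k * θ * Complex.I) *
        bub θ u ^ (-γ - 1 : ℂ) *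
        ((d + 1) * (Complex.exp (θ * Complex.I) - Complex.exp (-(θ * Complex.I))) * bub θ u
          + k * (Complex.exp (θ * Complex.I) + Complex.exp (-(θ * Complex.I))) * bub θ u
          - γ * (Complex.exp (θ * Complex.I) + Complex.exp (-(θ * Complex.I))) *
            (Complex.exp (θ * Complex.I) * u - Complex.exp (-(θ * Complex.I))))) = 0 := by
  have hpi := Real.pi_pos
  have hle : -(π / 2) ≤ π / 2 := by linarith
  have h := intervalIntegral.integral_eq_sub_of_hasDerivAt (a := -(π / 2)) (b := π / 2)
    (fun θ hθ => hasDerivAt_angle (d := d) (k := k) (γ := γ) (u := u) hd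
      (by rwa [uIcc_of_le hle] at hθ) hu hu1) ?_
  · simp only [cos_pi_div_two, cos_neg, mul_zero, zero_rpow (by linarith : d + 1 ≠ 0),
      Complex.ofReal_zero, zero_mul, sub_zero] at h
    rw [intervalIntegral.integral_const_mul, intervalIntegral.integral_of_le hle,
      integral_Ioc_eq_integral_Ioo] at h
    exact (mul_eq_zero.1 h).resolve_left Complex.I_ne_zero
  · refine ContinuousOn.intervalIntegrable ?_
    rw [uIcc_of_le hle]
    have hb : ContinuousOn (fun θ => bub θ u ^ (-γ - 1 : ℂ)) (Icc (-(π / 2)) (π / 2)) :=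
      (continuous_bub u).continuousOn.cpow_const
        fun θ hθ => bub_mem_slitPlane_of_ne_one hθ hu hu1
    have hb' := (continuous_bub u).continuousOn (s := Icc (-(π / 2)) (π / 2))
    have hc : Continuous (fun θ : ℝ => (((2 * cos θ) ^ d : ℝ) : ℂ)) :=
      Complex.continuous_ofReal.comp ((continuous_const.mul continuous_cos).rpow_const
        fun _ => Or.inr hd)
    refine continuousOn_const.mul (((hc.continuousOn.mul ?_).mul hb).mul ?_)
    · fun_prop
    · fun_prop

lemma exp_int_mul_I (a b θ : ℝ) : Complex.exp (((a + b : ℝ) : ℂ) * θ * Complex.I)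
      = Complex.exp (a * θ * Complex.I) * Complex.exp (b * θ * Complex.I) := by
  rw [← Complex.exp_add]; push_cast; ring_nf

lemma exp_mul_exp_neg (θ : ℝ) :
    Complex.exp (θ * Complex.I) * Complex.exp (-(θ * Complex.I)) = 1 := by
  rw [← Complex.exp_add]; simp

/-- First order relation satisfied by the density. -/
lemma bubInt_density_relation {d s u : ℝ} (hd : 0 ≤ d) (hs : 0 ≤ s) (hu : -1 < u) (hu1 : u ≠ 1) :
    (1 - s) * bubInt d (s - 2) (d + s) u
      = (1 - u) * ((d + s) * bubInt d (s - 1) (d + s + 1) u) := by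
  have h := integral_angle_eq_zero (k := s - 1) (γ := d + s) hd hu hu1
  have i1 := (integrable_bubFun' (d := d) (m := s - 2) (γ := d + s) hd (by linarith) hu
    hu1).const_mul (1 - s : ℂ)
  have i2 := (integrable_bubFun' (d := d) (m := s - 1) (γ := d + s + 1) hd (by linarith) hu
    hu1).const_mul ((1 - u : ℂ) * (d + s))
  have h2 : ∫ θ in angles, ((1 - s : ℂ) * bubFun d (s - 2) (d + s) u θ -
      ((1 - u : ℂ) * (d + s)) * bubFun d (s - 1) (d + s + 1) u θ) = 0 := by
    have : ∫ θ in angles, (-2 : ℂ) * ((1 - s : ℂ) * bubFun d (s - 2) (d + s) u θ -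
      ((1 - u : ℂ) * (d + s)) * bubFun d (s - 1) (d + s + 1) u θ) = 0 := by
      rw [← h]
      refine setIntegral_congr_fun measurableSet_Ioo fun θ hθ => ?_
      have hb0 := Complex.slitPlane_ne_zero (bub_mem_slitPlane hθ hu)
      have e1 : bub θ u ^ (-((d + s : ℝ) : ℂ)) = bub θ u ^ (-((d + s : ℝ) : ℂ) - 1) * bub θ u := by
        rw [Complex.cpow_sub _ _ hb0, Complex.cpow_one]; field_simp
      have e2 : (-((d + s + 1 : ℝ) : ℂ)) = -((d + s : ℝ) : ℂ) - 1 := by push_cast; ring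
      have e3 : Complex.exp (((s - 1 : ℝ) : ℂ) * θ * Complex.I) =
          Complex.exp (((s - 2 : ℝ) : ℂ) * θ * Complex.I) * Complex.exp (θ * Complex.I) := by
        have := exp_int_mul_I (s - 2) 1 θ
        rw [show s - 2 + 1 = s - 1 by ring] at this
        simpa using this
      have e4 := exp_mul_exp_neg θ
      simp only [bubFun]
      rw [e1, e2, e3]
      set W := Complex.exp (θ * Complex.I)
      set W' := Complex.exp (-(θ * Complex.I))
      have hb : bub θ u = W' + W * u := rfl
      rw [hb]
      push_cast
      linear_combination (-((((2 * cos θ) ^ d : ℝ) : ℂ) *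
        Complex.exp ((s - 2 : ℂ) * θ * Complex.I) * (W' + W * u) ^ (-(d + s : ℂ) - 1)) *
        (((1 - u) * (2 * d + 1 + s) - (1 - s) * (1 + u)) * W + (2 * s - 2) * W')) * e4
    rw [integral_const_mul] at this
    exact (mul_eq_zero.1 this).resolve_left (by norm_num)
  rw [integral_sub i1 i2, integral_const_mul, integral_const_mul] at h2
  rw [← mul_assoc (1 - u : ℂ)]
  exact sub_eq_zero.1 h2

/-- First order relation satisfied by the second derivative of the profile. -/
lemma bubInt_hessian_relation {d s u : ℝ} (hd : 0 ≤ d) (hs : s ≤ d) (hu : -1 < u) (hu1 : u ≠ 1) :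
    ((1 - u) * (d + 1) - (1 - s) * u) * bubInt d s (d - s + 2) u
      = u * (1 - u) * ((d - s + 2) * bubInt d (s + 1) (d - s + 2 + 1) u) := by
  have h := integral_angle_eq_zero (k := s - 1) (γ := d - s + 2) hd hu hu1
  have i1 := (integrable_bubFun' (d := d) (m := s) (γ := d - s + 2) hd (by linarith) hu
    hu1).const_mul ((1 - u) * (d + 1) - (1 - s) * u : ℂ)
  have i2 := (integrable_bubFun' (d := d) (m := s + 1) (γ := d - s + 2 + 1) hd (by linarith) hu
    hu1).const_mul (u * (1 - u) * (d - s + 2) : ℂ)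
  have h2 : ∫ θ in angles, (((1 - u) * (d + 1) - (1 - s) * u : ℂ) * bubFun d s (d - s + 2) u θ -
      (u * (1 - u) * (d - s + 2) : ℂ) * bubFun d (s + 1) (d - s + 2 + 1) u θ) = 0 := by
    have : ∫ θ in angles, (2 : ℂ) * (((1 - u) * (d + 1) - (1 - s) * u : ℂ) *
        bubFun d s (d - s + 2) u θ -
        (u * (1 - u) * (d - s + 2) : ℂ) * bubFun d (s + 1) (d - s + 2 + 1) u θ) = 0 := by
      rw [← h]
      refine setIntegral_congr_fun measurableSet_Ioo fun θ hθ => ?_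
      have hb0 := Complex.slitPlane_ne_zero (bub_mem_slitPlane hθ hu)
      have e1 : bub θ u ^ (-((d - s + 2 : ℝ) : ℂ)) =
          bub θ u ^ (-((d - s + 2 : ℝ) : ℂ) - 1) * bub θ u := by
        rw [Complex.cpow_sub _ _ hb0, Complex.cpow_one]; field_simp
      have e2 : (-((d - s + 2 + 1 : ℝ) : ℂ)) = -((d - s + 2 : ℝ) : ℂ) - 1 := by push_cast; ring
      have e3 : Complex.exp (((s + 1 : ℝ) : ℂ) * θ * Complex.I) =
          Complex.exp (((s - 1 : ℝ) : ℂ) * θ * Complex.I) * Complex.exp (θ * Complex.I) ^ 2 := by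
        have := exp_int_mul_I (s - 1) 2 θ
        rw [show s - 1 + 2 = s + 1 by ring] at this
        rw [this, ← Complex.exp_nat_mul]
        push_cast; ring_nf
      have e3' : Complex.exp ((s : ℂ) * θ * Complex.I) =
          Complex.exp (((s - 1 : ℝ) : ℂ) * θ * Complex.I) * Complex.exp (θ * Complex.I) := by
        have := exp_int_mul_I (s - 1) 1 θ
        rw [show s - 1 + 1 = s by ring] at this
        simpa using this
      simp only [bubFun]
      rw [e1, e2, e3, e3']
      set W := Complex.exp (θ * Complex.I)
      set W' := Complex.exp (-(θ * Complex.I))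
      have hb : bub θ u = W' + W * u := rfl
      rw [hb]
      push_cast
      ring
    rw [integral_const_mul] at this
    exact (mul_eq_zero.1 this).resolve_left (by norm_num)
  rw [integral_sub i1 i2, integral_const_mul, integral_const_mul] at h2
  rw [← mul_assoc (u * (1 - u) : ℂ)]
  exact sub_eq_zero.1 h2

lemma eq_of_hasDerivAt_zero {f : ℝ → ℝ} {a b : ℝ} (hab : a ≤ b)
    (h : ∀ x ∈ Icc a b, HasDerivAt f 0 x) : f b = f a :=
  constant_of_has_deriv_right_zero (fun x hx => (h x hx).continuousAt.continuousWithinAt)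
    (fun x hx => (h x ⟨hx.1, hx.2.le⟩).hasDerivWithinAt) b ⟨hab, le_rfl⟩

/-- The radial density, as a function of `u = |x|²`. -/
def dens (d s u : ℝ) : ℝ := (bubInt d (s - 2) (d + s) u).re

lemma HasDerivAt.re_complex {f : ℝ → ℂ} {f' : ℂ} {x : ℝ} (h : HasDerivAt f f' x) :
    HasDerivAt (fun x => (f x).re) f'.re x :=
  (Complex.reCLM.hasFDerivAt.comp_hasDerivAt x h)

lemma hasDerivAt_dens {d s u : ℝ} (hd : 0 ≤ d) (hs : 0 ≤ s) (hu : -1 < u) (hu1 : u ≠ 1) :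
    HasDerivAt (dens d s) (-((1 - s) * dens d s u / (1 - u))) u := by
  have h := (hasDerivAt_bubInt_of_ne_one (d := d) (m := s - 2) (γ := d + s) hd (by linarith)
    hu hu1).re_complex
  refine h.congr_deriv ?_
  have hr := congrArg Complex.re (bubInt_density_relation hd hs hu hu1)
  rw [show s - 2 + 1 = s - 1 by ring]
  have h1 : (1 - u : ℝ) ≠ 0 := sub_ne_zero.2 (Ne.symm hu1)
  have e1 : ((1 - s : ℂ) * bubInt d (s - 2) (d + s) u).re = (1 - s) * dens d s u := by
    rw [← Complex.ofReal_one, ← Complex.ofReal_sub, Complex.re_ofReal_mul, dens]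
  have e2 : ((1 - u : ℂ) * ((d + s) * bubInt d (s - 1) (d + s + 1) u)).re
      = (1 - u) * ((d + s) * (bubInt d (s - 1) (d + s + 1) u).re) := by
    rw [← Complex.ofReal_one, ← Complex.ofReal_sub, Complex.re_ofReal_mul, ← Complex.ofReal_add,
      Complex.re_ofReal_mul]
  rw [e1, e2] at hr
  rw [← Complex.ofReal_neg, Complex.re_ofReal_mul, hr]
  field_simp

lemma continuousAt_dens {d s u : ℝ} (hd : 0 ≤ d) (hs : 0 ≤ s) (hs1 : s < 1) (hu : -1 < u) :
    ContinuousAt (dens d s) u :=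
  Complex.continuous_re.continuousAt.comp (continuousAt_bubInt (by linarith) (by linarith) hu)

lemma dens_of_lt_one {d s u : ℝ} (hd : 0 ≤ d) (hs : 0 ≤ s) (hu : 0 ≤ u) (hu1 : u < 1) :
    dens d s u = dens d s 0 * (1 - u) ^ (1 - s) := by
  have h := eq_of_hasDerivAt_zero (f := fun v => dens d s v * (1 - v) ^ (s - 1)) hu fun x hx => by
    have hx1 : 0 < 1 - x := by linarith [hx.2]
    have h1 := hasDerivAt_dens (d := d) hd hs (by linarith [hx.1] : -1 < x) (by linarith [hx.2])
    have h2 := ((hasDerivAt_id x).const_sub 1).rpow_const (p := s - 1) (Or.inl hx1.ne')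
    refine (h1.mul h2).congr_deriv ?_
    simp only [id]
    rw [rpow_sub_one hx1.ne' (s - 1)]
    field_simp
    ring
  have hx1 : 0 < 1 - u := by linarith
  simp only [sub_zero, one_rpow, mul_one] at h
  rw [← h, mul_assoc, ← rpow_add hx1]
  simp

lemma dens_of_one_lt {d s u : ℝ} (hd : 0 ≤ d) (hs : 0 ≤ s) (hs1 : s < 1) (hds : 0 < d + s)
    (hu1 : 1 < u) : dens d s u = 0 := by
  have hc : ∀ w, u ≤ w → dens d s w * (w - 1) ^ (s - 1) = dens d s u * (u - 1) ^ (s - 1) := by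
    intro w hw
    refine eq_of_hasDerivAt_zero (f := fun v => dens d s v * (v - 1) ^ (s - 1)) hw fun x hx => ?_
    have hx1 : 0 < x - 1 := by linarith [hx.1]
    have h1 := hasDerivAt_dens (d := d) hd hs (by linarith [hx.1] : -1 < x) (by linarith [hx.1])
    have h2 := ((hasDerivAt_id x).sub_const 1).rpow_const (p := s - 1) (Or.inl hx1.ne')
    refine (h1.mul h2).congr_deriv ?_
    simp only [id]
    rw [rpow_sub_one hx1.ne' (s - 1)]
    have : 1 - x ≠ 0 := by linarith
    rw [← neg_sub 1 x]
    field_simp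
    ring
  obtain ⟨M, hM⟩ := exists_norm_bubInt_le (d := d) (s - 2) (γ := d + s) (by linarith) (by linarith)
  have hlim : Tendsto (fun w => M * (1 + w) ^ (-(d + s)) * (w - 1) ^ (-(1 - s))) atTop (nhds 0) := by
    have a1 : Tendsto (fun w : ℝ => (1 + w) ^ (-(d + s))) atTop (nhds 0) :=
      (tendsto_rpow_neg_atTop hds).comp (tendsto_atTop_add_const_left _ _ tendsto_id)
    have a2 : Tendsto (fun w : ℝ => (w - 1) ^ (-(1 - s))) atTop (nhds 0) :=
      (tendsto_rpow_neg_atTop (by linarith)).comp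
        (tendsto_atTop_add_const_right _ (-1) tendsto_id)
    simpa using (a1.const_mul M).mul a2
  have hlim2 : Tendsto (fun w => dens d s w * (w - 1) ^ (s - 1)) atTop (nhds 0) := by
    refine squeeze_zero_norm' ?_ hlim
    filter_upwards [eventually_ge_atTop u] with w hw
    have hw1 : 0 < w - 1 := by linarith
    rw [norm_mul, Real.norm_of_nonneg (rpow_nonneg hw1.le (s - 1)), neg_sub]
    refine mul_le_mul_of_nonneg_right ?_ (by positivity)
    exact (Complex.abs_re_le_norm _).trans (hM w (by linarith))
  have hlim3 : Tendsto (fun w => dens d s w * (w - 1) ^ (s - 1)) atTop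
      (nhds (dens d s u * (u - 1) ^ (s - 1))) :=
    tendsto_const_nhds.congr' (by
      filter_upwards [eventually_ge_atTop u] with w hw using (hc w hw).symm)
  have := tendsto_nhds_unique hlim3 hlim2
  exact (mul_eq_zero.1 this).resolve_right (rpow_pos_of_pos (by linarith) _).ne'

lemma dens_eq {d s u : ℝ} (hd : 0 ≤ d) (hs : 0 ≤ s) (hs1 : s < 1) (hds : 0 < d + s)
    (hu : 0 ≤ u) : dens d s u = dens d s 0 * (max (1 - u) 0) ^ (1 - s) := by
  have hne : 1 - s ≠ 0 := by linarith
  rcases lt_trichotomy u 1 with h | h | h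
  · rw [dens_of_lt_one hd hs hu h, max_eq_left (by linarith)]
  · rw [h, sub_self, max_self, zero_rpow hne, mul_zero]
    have h1 : Tendsto (dens d s) (nhdsWithin 1 (Ioi 1)) (nhds (dens d s 1)) :=
      (continuousAt_dens hd hs hs1 (by norm_num)).continuousWithinAt
    have h2 : Tendsto (dens d s) (nhdsWithin 1 (Ioi 1)) (nhds 0) :=
      tendsto_const_nhds.congr' (by
        filter_upwards [self_mem_nhdsWithin] with w hw
          using (dens_of_one_lt hd hs hs1 hds hw).symm)
    exact tendsto_nhds_unique h1 h2
  · rw [dens_of_one_lt hd hs hs1 hds h, max_eq_right (by linarith), zero_rpow hne, mul_zero]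

/-- The radial profile of the solution, as a function of `u = |x|²`. -/
def prof (d s u : ℝ) : ℝ := (bubInt d (s - 2) (d - s) u).re

/-- The derivative of `prof`. -/
def profD (d s u : ℝ) : ℝ := -(d - s) * (bubInt d (s - 1) (d - s + 1) u).re

/-- The second derivative of `prof`, up to a positive factor. -/
def profH (d s u : ℝ) : ℝ := (bubInt d s (d - s + 2) u).re

lemma hasDerivAt_prof {d s u : ℝ} (hs : 0 < s) (hsd : s < d) (hu : -1 < u) :
    HasDerivAt (prof d s) (profD d s u) u := by
  have h := (hasDerivAt_bubInt (d := d) (m := s - 2) (γ := d - s) (by linarith) (by linarith)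
    hu).re_complex
  refine h.congr_deriv ?_
  rw [show s - 2 + 1 = s - 1 by ring, ← Complex.ofReal_neg, Complex.re_ofReal_mul, profD]

lemma continuousAt_profD {d s u : ℝ} (hs : 0 < s) (hsd : s < d) (hu : -1 < u) :
    ContinuousAt (profD d s) u :=
  (Complex.continuous_re.continuousAt.comp
    (continuousAt_bubInt (by linarith) (by linarith) hu)).const_mul _

lemma hasDerivAt_profD {d s u : ℝ} (hs : 0 < s) (hsd : s < d) (hu : -1 < u) (hu1 : u ≠ 1) :
    HasDerivAt (profD d s) ((d - s) * (d - s + 1) * profH d s u) u := by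
  have h := ((hasDerivAt_bubInt_of_ne_one (d := d) (m := s - 1) (γ := d - s + 1) (by linarith)
    (by linarith) hu hu1).re_complex).const_mul (-(d - s))
  refine h.congr_deriv ?_
  rw [show s - 1 + 1 = s by ring, ← Complex.ofReal_neg, Complex.re_ofReal_mul, profH,
    show d - s + 1 + 1 = d - s + 2 by ring]
  ring

lemma exists_hasDerivAt_profH {d s u : ℝ} (hs : 0 < s) (hsd : s < d) (hu : -1 < u) (hu1 : u ≠ 1) :
    ∃ h', HasDerivAt (profH d s) h' u ∧
      ((1 - u) * (d + 1) - (1 - s) * u) * profH d s u + u * (1 - u) * h' = 0 := by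
  have h := (hasDerivAt_bubInt_of_ne_one (d := d) (m := s) (γ := d - s + 2) (by linarith)
    (by linarith) hu hu1).re_complex
  refine ⟨_, h, ?_⟩
  have hr := congrArg Complex.re (bubInt_hessian_relation (by linarith) hsd.le hu hu1)
  have e1 : (((1 - u) * (d + 1) - (1 - s) * u : ℂ) * bubInt d s (d - s + 2) u).re
      = ((1 - u) * (d + 1) - (1 - s) * u) * profH d s u := by
    rw [profH, ← Complex.re_ofReal_mul]; push_cast; rfl
  have e2 : ((u * (1 - u) * ((d - s + 2) * bubInt d (s + 1) (d - s + 2 + 1) u) : ℂ)).re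
      = u * (1 - u) * ((d - s + 2) * (bubInt d (s + 1) (d - s + 2 + 1) u).re) := by
    rw [← Complex.re_ofReal_mul, ← Complex.re_ofReal_mul]; push_cast; rfl
  rw [e1, e2] at hr
  rw [hr, ← Complex.ofReal_neg, Complex.re_ofReal_mul]
  ring

lemma profH_of_lt_one {d s u : ℝ} (hs : 0 < s) (hsd : s < d) (hu : 0 ≤ u) (hu1 : u < 1) :
    profH d s u = 0 := by
  rcases hu.eq_or_lt with h0 | h0
  · obtain ⟨h', -, h⟩ := exists_hasDerivAt_profH (d := d) hs hsd (by linarith : -1 < u) hu1.ne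
    rw [← h0] at h ⊢
    simp only [sub_zero, one_mul, mul_zero, zero_mul, add_zero] at h
    exact (mul_eq_zero.1 h).resolve_left (by linarith)
  have h := eq_of_hasDerivAt_zero
    (f := fun v => profH d s v * v ^ (d + 1) * (1 - v) ^ (1 - s)) hu fun x hx => by
    have hx1 : 0 < 1 - x := by linarith [hx.2]
    obtain ⟨h', h1, hrel⟩ := exists_hasDerivAt_profH (d := d) hs hsd
      (by linarith [hx.1] : -1 < x) (by linarith [hx.2])
    have h2 := ((hasDerivAt_id x).const_sub 1).rpow_const (p := 1 - s) (Or.inl hx1.ne')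
    have h3 := (hasDerivAt_id x).rpow_const (p := d + 1) (Or.inr (by linarith))
    refine ((h1.mul h3).mul h2).congr_deriv ?_
    simp only [id, Pi.mul_apply]
    rw [rpow_sub_one hx1.ne' (1 - s), rpow_add_one' hx.1 (by linarith), add_sub_cancel_right]
    field_simp
    linear_combination (x ^ d * (1 - x) ^ (1 - s)) * hrel
  simp only [zero_rpow (by linarith : d + 1 ≠ 0), mul_zero, zero_mul] at h
  have a1 : 0 < u ^ (d + 1) := by positivity
  have a2 : 0 < (1 - u) ^ (1 - s) := rpow_pos_of_pos (by linarith) _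
  exact (mul_eq_zero.1 ((mul_eq_zero.1 h).resolve_right a2.ne')).resolve_right a1.ne'

lemma exists_profH_eq {d s : ℝ} (hs : 0 < s) (hsd : s < d) :
    ∃ κ, ∀ u, 1 < u → profH d s u = κ * u ^ (-(d + 1)) * (u - 1) ^ (s - 1) := by
  have key : ∀ u v, 1 < u → u ≤ v → profH d s v * v ^ (d + 1) * (v - 1) ^ (1 - s)
      = profH d s u * u ^ (d + 1) * (u - 1) ^ (1 - s) := by
    intro u v hu huv
    refine eq_of_hasDerivAt_zero
      (f := fun v => profH d s v * v ^ (d + 1) * (v - 1) ^ (1 - s)) huv fun x hx => ?_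
    have hx1 : 0 < x - 1 := by linarith [hx.1]
    have hx0 : 0 < x := by linarith
    obtain ⟨h', h1, hrel⟩ := exists_hasDerivAt_profH (d := d) hs hsd
      (by linarith : -1 < x) (by linarith)
    have h2 := ((hasDerivAt_id x).sub_const 1).rpow_const (p := 1 - s) (Or.inl hx1.ne')
    have h3 := (hasDerivAt_id x).rpow_const (p := d + 1) (Or.inr (by linarith))
    refine ((h1.mul h3).mul h2).congr_deriv ?_
    simp only [id, Pi.mul_apply]
    rw [rpow_sub_one hx1.ne' (1 - s), rpow_add_one' hx0.le (by linarith), add_sub_cancel_right]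
    field_simp
    linear_combination (-(x ^ d * (x - 1) ^ (1 - s))) * hrel
  refine ⟨profH d s 2 * 2 ^ (d + 1) * (2 - 1) ^ (1 - s), fun u hu => ?_⟩
  have hk : profH d s 2 * 2 ^ (d + 1) * (2 - 1) ^ (1 - s)
      = profH d s u * u ^ (d + 1) * (u - 1) ^ (1 - s) := by
    rcases le_total u 2 with h | h
    · exact key u 2 hu h
    · exact (key 2 u (by norm_num) h).symm
  have hu1 : 0 < u - 1 := by linarith
  have hu0 : 0 < u := by linarith
  rw [hk]
  calc profH d s u = profH d s u * (u ^ (d + 1) * u ^ (-(d + 1))) *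
        ((u - 1) ^ (1 - s) * (u - 1) ^ (s - 1)) := by
        rw [← rpow_add hu0, ← rpow_add hu1]; simp
    _ = _ := by ring

lemma exp_mul_I_cpow {θ : ℝ} (hθ : θ ∈ angles) (γ : ℂ) :
    Complex.exp (θ * Complex.I) ^ γ = Complex.exp (γ * θ * Complex.I) := by
  have h1 := hθ.1
  have h2 := hθ.2
  have := pi_pos
  rw [Complex.cpow_def_of_ne_zero (Complex.exp_ne_zero _), Complex.log_exp]
  · congr 1; ring
  · simp; linarith
  · simp; linarith

lemma one_add_exp_cpow {d θ : ℝ} (hθ : θ ∈ angles) :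
    (1 + Complex.exp ((2 * θ : ℝ) * Complex.I)) ^ (d : ℂ)
      = ((2 * cos θ) ^ d : ℝ) * Complex.exp (d * θ * Complex.I) := by
  have hc := cos_pos_angles hθ
  have e : 1 + Complex.exp ((2 * θ : ℝ) * Complex.I)
      = ((2 * cos θ : ℝ) : ℂ) * Complex.exp (θ * Complex.I) := by
    push_cast
    rw [Complex.two_cos, add_mul, ← Complex.exp_add, ← Complex.exp_add, add_comm]
    congr 1
    · congr 1; ring
    · rw [neg_mul, neg_add_cancel, Complex.exp_zero]
  have hc2 : ((2 * cos θ : ℝ) : ℂ) ≠ 0 := Complex.ofReal_ne_zero.2 (by positivity)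
  rw [e, Complex.cpow_def_of_ne_zero (mul_ne_zero hc2 (Complex.exp_ne_zero _)), Complex.log_ofReal_mul (by positivity) (Complex.exp_ne_zero _),
    add_mul, Complex.exp_add, ← Complex.cpow_def_of_ne_zero (Complex.exp_ne_zero _),
    exp_mul_I_cpow hθ, Complex.ofReal_cpow (by positivity),
    Complex.cpow_def_of_ne_zero hc2, Complex.ofReal_log (by positivity)]

lemma integral_cos_rpow_mul_exp {d : ℝ} (hd : 0 < d) :
    ∫ θ in angles, (((2 * cos θ) ^ d : ℝ) : ℂ) * Complex.exp (d * θ * Complex.I) = π := by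
  have hdiff : DiffContOnCl ℂ (fun z : ℂ => (1 + z) ^ (d : ℂ)) (Metric.ball 0 |1|) := by
    rw [abs_one]
    constructor
    · intro z hz
      refine (DifferentiableAt.cpow_const (by fun_prop) ?_).differentiableWithinAt
      left
      have := Complex.abs_re_le_norm z
      have h2 : ‖z‖ < 1 := by simpa using hz
      have := neg_abs_le z.re
      simp only [Complex.add_re, Complex.one_re]
      linarith
    · rw [closure_ball _ one_ne_zero]
      intro z hz
      have hz1 : ‖z‖ ≤ 1 := by simpa using hz
      refine ContinuousAt.continuousWithinAt ?_
      refine ContinuousAt.comp (g := fun w : ℂ => w ^ (d : ℂ)) (f := fun z : ℂ => 1 + z) ?_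
        (by fun_prop)
      refine Complex.continuousAt_cpow_const_of_re_pos ?_ (by simpa using hd)
      left
      have := Complex.abs_re_le_norm z
      have := neg_abs_le z.re
      simp only [Complex.add_re, Complex.one_re]
      linarith
  have h := hdiff.circleAverage
  have hper : Function.Periodic (fun φ : ℝ => (1 + circleMap 0 1 φ) ^ (d : ℂ)) (2 * π) := by
    intro φ
    simp only [periodic_circleMap 0 1 φ]
  rw [Real.circleAverage_def] at h
  have h2 := hper.intervalIntegral_add_eq 0 (-π)
  rw [zero_add, show -π + 2 * π = π by ring] at h2
  rw [h2] at h
  have h3 : ∫ θ in (-(π / 2))..(π / 2), (1 + circleMap 0 1 (2 * θ)) ^ (d : ℂ)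
      = (2⁻¹ : ℝ) • ∫ θ in (-π)..π, (1 + circleMap 0 1 θ) ^ (d : ℂ) := by
    rw [intervalIntegral.integral_comp_mul_left
      (fun φ => (1 + circleMap 0 1 φ) ^ (d : ℂ)) two_ne_zero]
    congr 2 <;> ring
  have h4 : ∫ θ in angles, (((2 * cos θ) ^ d : ℝ) : ℂ) * Complex.exp (d * θ * Complex.I)
      = ∫ θ in (-(π / 2))..(π / 2), (1 + circleMap 0 1 (2 * θ)) ^ (d : ℂ) := by
    rw [intervalIntegral.integral_of_le (by linarith [pi_pos]), integral_Ioc_eq_integral_Ioo]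
    refine setIntegral_congr_fun measurableSet_Ioo fun θ hθ => ?_
    simp only [circleMap, Complex.ofReal_one, one_mul, zero_add]
    exact (one_add_exp_cpow hθ).symm
  rw [h4, h3]
  have hpi := pi_pos.ne'
  have h5 : ∫ θ in (-π)..π, (1 + circleMap 0 1 θ) ^ (d : ℂ) = ((2 * π : ℝ) : ℂ) := by
    have := congrArg (fun w => (2 * π) • w) h
    simp only [smul_smul] at this
    rw [mul_inv_cancel₀ (by positivity), one_smul] at this
    rw [this]; simp
  rw [h5]
  simp

lemma profD_zero {d s : ℝ} (hs : 0 < s) (hsd : s < d) : profD d s 0 = -(d - s) * π := by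
  have : bubInt d (s - 1) (d - s + 1) 0 = π := by
    rw [← integral_cos_rpow_mul_exp (hs.trans hsd), bubInt]
    refine setIntegral_congr_fun measurableSet_Ioo fun θ hθ => ?_
    simp only [bubFun, bub, Complex.ofReal_zero, mul_zero, add_zero]
    have hθ' : -θ ∈ angles := ⟨by linarith [hθ.2], by linarith [hθ.1]⟩
    have := exp_mul_I_cpow hθ' (-((d - s + 1 : ℝ) : ℂ))
    rw [Complex.ofReal_neg, neg_mul] at this
    rw [this, mul_assoc, ← Complex.exp_add]
    congr 2
    push_cast
    ring
  rw [profD, this, Complex.ofReal_re]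

lemma profD_of_le_one {d s u : ℝ} (hs : 0 < s) (hsd : s < d) (hu : 0 ≤ u) (hu1 : u ≤ 1) :
    profD d s u = profD d s 0 := by
  have key : ∀ v ∈ Icc (0 : ℝ) 1, profD d s v = profD d s 0 := by
    refine constant_of_has_deriv_right_zero
      (fun v hv => (continuousAt_profD hs hsd (by linarith [hv.1])).continuousWithinAt)
      fun v hv => ?_
    have h := hasDerivAt_profD hs hsd (by linarith [hv.1] : -1 < v) hv.2.ne
    rw [profH_of_lt_one hs hsd hv.1 hv.2, mul_zero] at h
    exact h.hasDerivWithinAt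
  exact key u ⟨hu, hu1⟩

lemma tendsto_re_bubInt {d m γ : ℝ} (hγ : 0 < γ) (hγd : γ < d + 1) :
    Tendsto (fun u => (bubInt d m γ u).re) atTop (nhds 0) := by
  obtain ⟨M, hM⟩ := exists_norm_bubInt_le m hγ.le hγd
  have hlim : Tendsto (fun u : ℝ => M * (1 + u) ^ (-γ)) atTop (nhds 0) := by
    simpa using ((tendsto_rpow_neg_atTop hγ).comp
      (tendsto_atTop_add_const_left _ 1 tendsto_id)).const_mul M
  refine squeeze_zero_norm' ?_ hlim
  filter_upwards [eventually_ge_atTop 0] with u hu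
  exact (Complex.abs_re_le_norm _).trans (hM u (by linarith))

lemma tendsto_profD {d s : ℝ} (hs : 0 < s) (hsd : s < d) :
    Tendsto (profD d s) atTop (nhds 0) := by
  have h := (tendsto_re_bubInt (d := d) (m := s - 1) (γ := d - s + 1) (by linarith)
    (by linarith)).const_mul (-(d - s))
  rw [mul_zero] at h
  exact h

lemma tendsto_prof {d s : ℝ} (hs : 0 < s) (hsd : s < d) :
    Tendsto (prof d s) atTop (nhds 0) :=
  tendsto_re_bubInt (by linarith) (by linarith)

lemma profD_zero_neg {d s : ℝ} (hs : 0 < s) (hsd : s < d) : profD d s 0 < 0 := by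
  rw [profD_zero hs hsd]
  nlinarith [pi_pos]

lemma exists_hasDerivAt_profD_eq {d s : ℝ} (hs : 0 < s) (hsd : s < d) :
    ∃ κ, 0 < κ ∧ ∀ u, 1 < u → HasDerivAt (profD d s) (κ * u ^ (-(d + 1)) * (u - 1) ^ (s - 1)) u := by
  obtain ⟨κ, hκ⟩ := exists_profH_eq (d := d) hs hsd
  have hder : ∀ u, 1 < u → HasDerivAt (profD d s)
      ((d - s) * (d - s + 1) * κ * u ^ (-(d + 1)) * (u - 1) ^ (s - 1)) u := by
    intro u hu
    refine (hasDerivAt_profD hs hsd (by linarith) hu.ne').congr_deriv ?_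
    rw [hκ u hu]; ring
  refine ⟨_, ?_, hder⟩
  by_contra hneg
  push Not at hneg
  have hanti : AntitoneOn (profD d s) (Ici 1) := by
    refine antitoneOn_of_hasDerivWithinAt_nonpos (convex_Ici 1)
      (fun v hv => (continuousAt_profD hs hsd
        (by linarith [mem_Ici.1 hv])).continuousWithinAt)
      (fun v hv => (hder v (by simpa using hv)).hasDerivWithinAt) fun v hv => ?_
    have hv : 1 < v := by simpa using hv
    have a1 : 0 < v ^ (-(d + 1)) := rpow_pos_of_pos (by linarith) _
    have a2 : 0 < (v - 1) ^ (s - 1) := rpow_pos_of_pos (by linarith) _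
    rw [mul_assoc]
    exact mul_nonpos_of_nonpos_of_nonneg hneg (by positivity)
  have h1 : (0 : ℝ) ≤ profD d s 1 := by
    refine le_of_tendsto (tendsto_profD hs hsd) ?_
    filter_upwards [eventually_ge_atTop 1] with u hu
    exact hanti (mem_Ici.2 le_rfl) (mem_Ici.2 hu) hu
  rw [profD_of_le_one hs hsd zero_le_one le_rfl] at h1
  linarith [profD_zero_neg hs hsd]

lemma monotoneOn_profD {d s : ℝ} (hs : 0 < s) (hsd : s < d) :
    MonotoneOn (profD d s) (Ici 1) := by
  obtain ⟨κ, hκ, hder⟩ := exists_hasDerivAt_profD_eq hs hsd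
  refine monotoneOn_of_hasDerivWithinAt_nonneg (convex_Ici 1)
    (fun v hv => (continuousAt_profD hs hsd
      (by linarith [mem_Ici.1 hv])).continuousWithinAt)
    (fun v hv => (hder v (by simpa using hv)).hasDerivWithinAt) fun v hv => ?_
  have hv : 1 < v := by simpa using hv
  have a1 : 0 < v ^ (-(d + 1)) := rpow_pos_of_pos (by linarith) _
  have a2 : 0 < (v - 1) ^ (s - 1) := rpow_pos_of_pos (by linarith) _
  positivity

lemma profD_eq_max {d s u : ℝ} (hs : 0 < s) (hsd : s < d) (hu : 0 ≤ u) :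
    profD d s u = profD d s (max u 1) := by
  rcases le_total u 1 with h | h
  · rw [max_eq_right h, profD_of_le_one hs hsd hu h, profD_of_le_one hs hsd zero_le_one le_rfl]
  · rw [max_eq_left h]

lemma profD_nonpos {d s u : ℝ} (hs : 0 < s) (hsd : s < d) (hu : 0 ≤ u) : profD d s u ≤ 0 := by
  rw [profD_eq_max hs hsd hu]
  refine ge_of_tendsto (tendsto_profD hs hsd) ?_
  filter_upwards [eventually_ge_atTop (max u 1)] with v hv
  exact monotoneOn_profD hs hsd (mem_Ici.2 (le_max_right _ _))
    (mem_Ici.2 ((le_max_right _ _).trans hv)) hv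

lemma profD_zero_le {d s u : ℝ} (hs : 0 < s) (hsd : s < d) (hu : 0 ≤ u) :
    profD d s 0 ≤ profD d s u := by
  rw [profD_eq_max hs hsd hu, ← profD_of_le_one hs hsd zero_le_one le_rfl]
  exact monotoneOn_profD hs hsd (mem_Ici.2 le_rfl) (mem_Ici.2 (le_max_right _ _))
    (le_max_right _ _)

lemma rpow_sub_rpow_le {x y p : ℝ} (hx : 0 ≤ x) (hxy : x ≤ y) (hp : 0 ≤ p) (hp1 : p ≤ 1) :
    y ^ p - x ^ p ≤ (y - x) ^ p := by
  have := Real.rpow_add_le_add_rpow hx (sub_nonneg.2 hxy) hp hp1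
  rw [add_sub_cancel] at this
  linarith

lemma exists_abs_profD_sub_le {d s : ℝ} (hs : 0 < s) (hs1 : s < 1) (hsd : s < d) :
    ∃ M, 0 ≤ M ∧ ∀ u v, 0 ≤ u → 0 ≤ v →
      |profD d s u - profD d s v| ≤ M * |u - v| ^ s := by
  obtain ⟨κ, hκ, hder⟩ := exists_hasDerivAt_profD_eq hs hsd
  have hmono : MonotoneOn (fun u => κ / s * (u - 1) ^ s - profD d s u) (Ici 1) := by
    refine monotoneOn_of_hasDerivWithinAt_nonneg (convex_Ici 1) (f' := fun u =>
        κ / s * (1 * s * (u - 1) ^ (s - 1)) - κ * u ^ (-(d + 1)) * (u - 1) ^ (s - 1))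
      (fun v hv => ?_) (fun v hv => ?_) fun v hv => ?_
    · refine ContinuousAt.continuousWithinAt (ContinuousAt.sub ?_ (continuousAt_profD hs hsd
        (by linarith [mem_Ici.1 hv])))
      exact (((continuous_id.sub continuous_const).continuousAt).rpow_const
        (Or.inr hs.le)).const_mul _
    · have hv : 1 < v := by simpa using hv
      exact (((((hasDerivAt_id v).sub_const 1).rpow_const
        (Or.inl (by simp only [id]; linarith))).const_mul _).sub (hder v hv)).hasDerivWithinAt
    · have hv : 1 < v := by simpa using hv
      have a1 : v ^ (-(d + 1)) ≤ 1 := rpow_le_one_of_one_le_of_nonpos hv.le (by linarith)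
      have a2 : 0 < (v - 1) ^ (s - 1) := rpow_pos_of_pos (by linarith) _
      have : κ / s * (1 * s * (v - 1) ^ (s - 1)) - κ * v ^ (-(d + 1)) * (v - 1) ^ (s - 1)
          = κ * (v - 1) ^ (s - 1) * (1 - v ^ (-(d + 1))) := by
        field_simp
      rw [this]
      exact mul_nonneg (by positivity) (by linarith)
  have key : ∀ u v, 1 ≤ u → u ≤ v → |profD d s u - profD d s v| ≤ κ / s * |u - v| ^ s := by
    intro u v hu huv
    have h1 := monotoneOn_profD hs hsd (mem_Ici.2 hu) (mem_Ici.2 (hu.trans huv)) huv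
    have h2 := hmono (mem_Ici.2 hu) (mem_Ici.2 (hu.trans huv)) huv
    have h3 := rpow_sub_rpow_le (sub_nonneg.2 hu) (sub_le_sub_right huv 1) hs.le hs1.le
    have h4 : 0 < κ / s := by positivity
    rw [abs_sub_comm, abs_sub_comm u, abs_of_nonneg (by linarith), abs_of_nonneg (by linarith)]
    rw [sub_sub_sub_cancel_right] at h3
    simp only at h2
    nlinarith
  refine ⟨κ / s, by positivity, fun u v hu hv => ?_⟩
  rw [profD_eq_max hs hsd hu, profD_eq_max hs hsd hv]
  have hle : |max u 1 - max v 1| ≤ |u - v| := abs_max_sub_max_le_abs u v 1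
  refine le_trans ?_ (mul_le_mul_of_nonneg_left (rpow_le_rpow (abs_nonneg _) hle hs.le)
    (by positivity))
  rcases le_total (max u 1) (max v 1) with h | h
  · exact key _ _ (le_max_right _ _) h
  · rw [abs_sub_comm, abs_sub_comm (max u 1)]
    exact key _ _ (le_max_right _ _) h

lemma antitoneOn_prof {d s : ℝ} (hs : 0 < s) (hsd : s < d) :
    AntitoneOn (prof d s) (Ici 0) := by
  refine antitoneOn_of_hasDerivWithinAt_nonpos (convex_Ici 0)
    (fun v hv => (hasDerivAt_prof hs hsd
      (by linarith [mem_Ici.1 hv])).continuousAt.continuousWithinAt)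
    (fun v hv => (hasDerivAt_prof hs hsd ?_).hasDerivWithinAt) fun v hv => ?_
  · have : 0 < v := by simpa using hv
    linarith
  · exact profD_nonpos hs hsd (interior_subset hv)

lemma prof_nonneg {d s u : ℝ} (hs : 0 < s) (hsd : s < d) (hu : 0 ≤ u) : 0 ≤ prof d s u := by
  refine le_of_tendsto (tendsto_prof hs hsd) ?_
  filter_upwards [eventually_ge_atTop u] with v hv
  exact antitoneOn_prof hs hsd hu (hu.trans hv) hv

lemma prof_of_le_one {d s u : ℝ} (hs : 0 < s) (hsd : s < d) (hu : 0 ≤ u) (hu1 : u ≤ 1) :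
    prof d s u = prof d s 0 + profD d s 0 * u := by
  have key : ∀ v ∈ Icc (0 : ℝ) 1, prof d s v - profD d s 0 * v
      = prof d s 0 - profD d s 0 * 0 := by
    have hd : ∀ v, 0 ≤ v → HasDerivAt (fun v => prof d s v - profD d s 0 * v)
        (profD d s v - profD d s 0 * 1) v := fun v hv =>
      (hasDerivAt_prof hs hsd (by linarith)).sub ((hasDerivAt_id v).const_mul _)
    refine constant_of_has_deriv_right_zero
      (fun v hv => (hd v hv.1).continuousAt.continuousWithinAt) fun v hv => ?_
    have h := hd v hv.1
    rw [profD_of_le_one hs hsd hv.1 hv.2.le, mul_one, sub_self] at h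
    exact h.hasDerivWithinAt
  linarith [key u ⟨hu, hu1⟩]

lemma le_prof {d s u : ℝ} (hs : 0 < s) (hsd : s < d) (hu : 0 ≤ u) :
    prof d s 0 + profD d s 0 * u ≤ prof d s u := by
  have hd : ∀ v, 0 ≤ v → HasDerivAt (fun v => prof d s v - profD d s 0 * v)
      (profD d s v - profD d s 0 * 1) v := fun v hv =>
    (hasDerivAt_prof hs hsd (by linarith)).sub ((hasDerivAt_id v).const_mul _)
  have hmono : MonotoneOn (fun v => prof d s v - profD d s 0 * v) (Ici 0) := by
    refine monotoneOn_of_hasDerivWithinAt_nonneg (convex_Ici 0)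
      (fun v hv => (hd v hv).continuousAt.continuousWithinAt)
      (fun v hv => (hd v (interior_subset hv)).hasDerivWithinAt) fun v hv => ?_
    linarith [profD_zero_le hs hsd (interior_subset hv : (0 : ℝ) ≤ v)]
  have := hmono (mem_Ici.2 le_rfl) (mem_Ici.2 hu) hu
  simp only at this
  linarith

lemma prof_zero_pos {d s : ℝ} (hs : 0 < s) (hsd : s < d) : 0 < prof d s 0 := by
  have h1 := prof_nonneg hs hsd (zero_le_one' ℝ)
  rw [prof_of_le_one hs hsd zero_le_one le_rfl] at h1
  linarith [profD_zero_neg hs hsd]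

lemma mul_cpow_of_re_pos {a w : ℂ} (ha : 0 < a.re) (hw : 0 < w.re) (γ : ℂ) :
    (a * w) ^ γ = a ^ γ * w ^ γ := by
  have ha0 : a ≠ 0 := fun h => by simp [h] at ha
  have hw0 : w ≠ 0 := fun h => by simp [h] at hw
  have h1 := Complex.abs_arg_lt_pi_div_two_iff.2 (Or.inl ha)
  have h2 := Complex.abs_arg_lt_pi_div_two_iff.2 (Or.inl hw)
  rw [abs_lt] at h1 h2
  rw [Complex.cpow_def_of_ne_zero (mul_ne_zero ha0 hw0), Complex.cpow_def_of_ne_zero ha0,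
    Complex.cpow_def_of_ne_zero hw0, Complex.log_mul ha0 hw0 ⟨by linarith, by linarith⟩, add_mul,
    Complex.exp_add]

lemma ofReal_mul_cpow {t : ℝ} (ht : 0 < t) {w : ℂ} (hw : 0 < w.re) (γ : ℂ) :
    ((t : ℂ) * w) ^ γ = (t : ℂ) ^ γ * w ^ γ :=
  mul_cpow_of_re_pos (by simpa using ht) hw γ

lemma integrableOn_rpow_mul_exp {p c : ℝ} (hp : 0 < p) (hc : 0 < c) :
    IntegrableOn (fun r : ℝ => r ^ (p - 1) * rexp (-(r * c))) (Ioi 0) := by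
  have := integrableOn_rpow_mul_exp_neg_mul_rpow (p := 1) (s := p - 1) (b := c)
    (by linarith) one_pos hc
  refine this.congr_fun (fun r _ => ?_) measurableSet_Ioi
  simp only [rpow_one]
  congr 2
  ring

lemma norm_rpow_mul_cexp {p r : ℝ} (hr : 0 < r) (w : ℂ) :
    ‖((r ^ p : ℝ) : ℂ) * Complex.exp (-(r * w))‖ = r ^ p * rexp (-(r * w.re)) := by
  rw [norm_mul, Complex.norm_real, Real.norm_of_nonneg (rpow_nonneg hr.le _), Complex.norm_exp]
  simp

lemma measurable_rpow_mul_cexp (p : ℝ) (w : ℂ) :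
    Measurable (fun r : ℝ => ((r ^ p : ℝ) : ℂ) * Complex.exp (-(r * w))) :=
  (Complex.measurable_ofReal.comp (measurable_id.pow_const p)).mul (by fun_prop)

lemma integrableOn_rpow_mul_cexp {p : ℝ} {w : ℂ} (hp : 0 < p) (hw : 0 < w.re) :
    IntegrableOn (fun r : ℝ => ((r ^ (p - 1) : ℝ) : ℂ) * Complex.exp (-(r * w))) (Ioi 0) := by
  refine Integrable.mono' (integrableOn_rpow_mul_exp hp hw)
    (measurable_rpow_mul_cexp _ _).aestronglyMeasurable ?_
  filter_upwards [ae_restrict_mem measurableSet_Ioi] with r hr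
  rw [norm_rpow_mul_cexp hr]

lemma integral_rpow_mul_cexp {p : ℝ} {w : ℂ} (hp : 0 < p) (hw : 0 < w.re) :
    ∫ r in Ioi (0 : ℝ), ((r ^ (p - 1) : ℝ) : ℂ) * Complex.exp (-(r * w))
      = Real.Gamma p * w ^ (-(p : ℂ)) := by
  set f : ℂ → ℂ := fun w => ∫ r in Ioi (0 : ℝ), ((r ^ (p - 1) : ℝ) : ℂ) * Complex.exp (-(r * w))
  set g : ℂ → ℂ := fun w => Real.Gamma p * w ^ (-(p : ℂ))
  have hopen : IsOpen {w : ℂ | 0 < w.re} := isOpen_lt continuous_const Complex.continuous_re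
  have hf : DifferentiableOn ℂ f {w : ℂ | 0 < w.re} := by
    intro w hw
    have hw : 0 < w.re := hw
    refine DifferentiableAt.differentiableWithinAt (HasDerivAt.differentiableAt
      (hasDerivAt_integral_of_dominated_loc_of_deriv_le
      (F := fun w (r : ℝ) => ((r ^ (p - 1) : ℝ) : ℂ) * Complex.exp (-(r * w)))
      (F' := fun w (r : ℝ) => ((r ^ (p - 1) : ℝ) : ℂ) * (Complex.exp (-(r * w)) * (-(r * 1))))
      (bound := fun r => r ^ (p + 1 - 1) * rexp (-(r * (w.re / 2))))
      (Metric.ball_mem_nhds w (half_pos hw)) ?_ ?_ ?_ ?_ ?_ ?_).2)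
    · exact Eventually.of_forall fun w => (measurable_rpow_mul_cexp _ _).aestronglyMeasurable
    · exact integrableOn_rpow_mul_cexp hp hw
    · exact ((Complex.measurable_ofReal.comp (measurable_id.pow_const _)).mul
        (by fun_prop)).aestronglyMeasurable
    · filter_upwards [ae_restrict_mem measurableSet_Ioi] with r hr v hv
      have hr : 0 < r := hr
      have hv1 : w.re / 2 ≤ v.re := by
        have h1 := Complex.abs_re_le_norm (v - w)
        rw [Metric.mem_ball, dist_eq_norm] at hv
        have h2 := neg_abs_le (v - w).re
        rw [Complex.sub_re] at h1 h2
        linarith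
      rw [← mul_assoc, norm_mul, norm_rpow_mul_cexp hr, mul_one, norm_neg, Complex.norm_real,
        Real.norm_of_nonneg hr.le, add_sub_right_comm, rpow_add_one hr.ne', mul_right_comm]
      gcongr
    · exact integrableOn_rpow_mul_exp (by linarith) (half_pos hw)
    · refine Eventually.of_forall fun r v _ => ?_
      exact ((((hasDerivAt_id v).const_mul (r : ℂ)).neg).cexp).const_mul _
  have hg : DifferentiableOn ℂ g {w : ℂ | 0 < w.re} := fun w hw =>
    ((differentiableAt_id.cpow_const (Or.inl hw)).const_mul _).differentiableWithinAt
  have key := (hf.analyticOnNhd hopen).eqOn_of_preconnected_of_frequently_eq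
    (hg.analyticOnNhd hopen) (convex_halfSpace_re_gt 0).isPreconnected
    (show (1 : ℂ) ∈ {w : ℂ | 0 < w.re} by simp) ?_
  · exact key hw
  have hev : ∀ᶠ x : ℝ in nhdsWithin 1 {1}ᶜ, f x = g x := by
    filter_upwards [nhdsWithin_le_nhds (Ioi_mem_nhds (zero_lt_one' ℝ))] with x hx
    have hx : 0 < x := hx
    have := Real.integral_rpow_mul_exp_neg_mul_Ioi hp hx
    simp only [f, g]
    rw [show (-(p : ℂ)) = ((-p : ℝ) : ℂ) by simp, ← Complex.ofReal_cpow hx.le,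
      ← Complex.ofReal_mul, rpow_neg hx.le, ← inv_rpow hx.le, ← one_div, mul_comm, ← this,
      ← integral_complex_ofReal]
    refine integral_congr_ae (Eventually.of_forall fun r => ?_)
    simp only [Complex.ofReal_mul, Complex.ofReal_exp, Complex.ofReal_neg]
    rw [mul_comm (r : ℂ)]
  have htend : Tendsto (fun x : ℝ => (x : ℂ)) (nhdsWithin 1 {1}ᶜ) (nhdsWithin 1 {1}ᶜ) := by
    refine tendsto_nhdsWithin_of_tendsto_nhds_of_eventually_within _ ?_ ?_
    · exact (Complex.continuous_ofReal.tendsto' 1 1 (by simp)).mono_left nhdsWithin_le_nhds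
    · filter_upwards [self_mem_nhdsWithin] with x hx
      simpa using hx
  exact htend.frequently hev.frequently

lemma one_sub_exp_neg_le (ρ : ℝ) : 1 - rexp (-ρ) ≤ ρ := by
  linarith [Real.add_one_le_exp (-ρ)]

lemma one_sub_exp_neg_nonneg {ρ : ℝ} (h : 0 ≤ ρ) : 0 ≤ 1 - rexp (-ρ) := by
  have : rexp (-ρ) ≤ 1 := Real.exp_le_one_iff.2 (by linarith)
  linarith

lemma integrableOn_rpow_mul_one_sub_exp {s : ℝ} (hs : 0 < s) (hs1 : s < 1) :
    IntegrableOn (fun ρ : ℝ => ρ ^ (-1 - s) * (1 - rexp (-ρ))) (Ioi 0) := by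
  have hm : Measurable (fun ρ : ℝ => ρ ^ (-1 - s) * (1 - rexp (-ρ))) :=
    (measurable_id.pow_const _).mul (by fun_prop)
  rw [← Ioc_union_Ioi_eq_Ioi zero_le_one]
  refine IntegrableOn.union ?_ ?_
  · have h1 : IntegrableOn (fun ρ : ℝ => ρ ^ (-s)) (Ioc 0 1) := by
      rw [← intervalIntegrable_iff_integrableOn_Ioc_of_le zero_le_one]
      exact intervalIntegral.intervalIntegrable_rpow' (by linarith)
    refine Integrable.mono' h1 hm.aestronglyMeasurable ?_
    filter_upwards [ae_restrict_mem measurableSet_Ioc] with ρ hρ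
    have h0 : 0 < ρ := hρ.1
    rw [Real.norm_of_nonneg (mul_nonneg (by positivity) (one_sub_exp_neg_nonneg h0.le)),
      show -s = -1 - s + 1 by ring, rpow_add_one h0.ne']
    exact mul_le_mul_of_nonneg_left (one_sub_exp_neg_le ρ) (by positivity)
  · refine Integrable.mono' (integrableOn_Ioi_rpow_of_lt (by linarith : -1 - s < -1) one_pos)
      hm.aestronglyMeasurable ?_
    filter_upwards [ae_restrict_mem measurableSet_Ioi] with ρ hρ
    have h0 : 0 < ρ := lt_trans one_pos hρ
    rw [Real.norm_of_nonneg (mul_nonneg (by positivity) (one_sub_exp_neg_nonneg h0.le))]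
    refine mul_le_of_le_one_right (by positivity) ?_
    linarith [Real.exp_pos (-ρ)]

lemma integral_rpow_mul_one_sub_exp_pos {s : ℝ} (hs : 0 < s) (hs1 : s < 1) :
    0 < ∫ ρ in Ioi (0 : ℝ), ρ ^ (-1 - s) * (1 - rexp (-ρ)) := by
  rw [setIntegral_pos_iff_support_of_nonneg_ae]
  · have : Ioi (0 : ℝ) ⊆ Function.support (fun ρ : ℝ => ρ ^ (-1 - s) * (1 - rexp (-ρ))) := by
      intro ρ hρ
      have hρ : 0 < ρ := hρ
      have h1 : rexp (-ρ) < 1 := by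
        rw [← Real.exp_zero]; exact Real.exp_lt_exp.2 (by linarith)
      exact (mul_pos (rpow_pos_of_pos hρ _) (by linarith)).ne'
    rw [inter_eq_right.2 this]
    simp
  · filter_upwards [ae_restrict_mem measurableSet_Ioi] with ρ hρ
    have h0 : 0 < ρ := hρ
    exact mul_nonneg (by positivity) (one_sub_exp_neg_nonneg h0.le)
  · exact integrableOn_rpow_mul_one_sub_exp hs hs1

/-- The constant in `integral_rpow_mul_cpow_sub`. -/
def kerConst (d s : ℝ) : ℝ :=
  Real.Gamma (d + s) / Real.Gamma d * ∫ ρ in Ioi (0 : ℝ), ρ ^ (-1 - s) * (1 - rexp (-ρ))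

lemma kerConst_pos {d s : ℝ} (hd : 0 < d) (hs : 0 < s) (hs1 : s < 1) : 0 < kerConst d s :=
  mul_pos (div_pos (Real.Gamma_pos_of_pos (by linarith)) (Real.Gamma_pos_of_pos hd))
    (integral_rpow_mul_one_sub_exp_pos hs hs1)

lemma integral_rpow_mul_cpow_sub {d s : ℝ} {b : ℂ} (hd : 0 < d) (hs : 0 < s) (hs1 : s < 1)
    (hb : 0 < b.re) :
    ∫ t in Ioi (0 : ℝ), ((t ^ (d + s - 1) : ℝ) : ℂ) *
      ((t * b) ^ (-(d : ℂ)) - (1 + t * b) ^ (-(d : ℂ)))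
      = kerConst d s * b ^ (-((d + s : ℝ) : ℂ)) := by
  set μ : Measure ℝ := volume.restrict (Ioi 0)
  set F : ℝ → ℝ → ℂ := fun t ρ => ((t ^ (d + s - 1) : ℝ) : ℂ) * (((ρ ^ (d - 1) : ℝ) : ℂ) *
    (Complex.exp (-(ρ * (t * b))) - Complex.exp (-(ρ * (1 + t * b))))) with hF
  have hF' : ∀ t ρ : ℝ, F t ρ = ((ρ ^ (d - 1) * (1 - rexp (-ρ)) : ℝ) : ℂ) *
      (((t ^ (d + s - 1) : ℝ) : ℂ) * Complex.exp (-(t * (ρ * b)))) := by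
    intro t ρ
    have : Complex.exp (-(ρ * (1 + t * b))) = Complex.exp (-ρ) * Complex.exp (-(t * (ρ * b))) := by
      rw [← Complex.exp_add]; congr 1; ring
    simp only [hF]
    rw [this, show (ρ : ℂ) * (t * b) = t * (ρ * b) by ring]
    push_cast
    ring
  have hρ : ∀ t : ℝ, 0 < t → ∫ ρ, F t ρ ∂μ = Real.Gamma d * (((t ^ (d + s - 1) : ℝ) : ℂ) *
      ((t * b) ^ (-(d : ℂ)) - (1 + t * b) ^ (-(d : ℂ)))) := by
    intro t ht
    have h1 : 0 < ((t : ℂ) * b).re := by simpa using mul_pos ht hb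
    have h2 : 0 < (1 + (t : ℂ) * b).re := by
      rw [Complex.add_re, Complex.one_re]; linarith
    simp only [hF, mul_sub]
    rw [integral_sub]
    · rw [integral_const_mul, integral_const_mul, integral_rpow_mul_cexp hd h1,
        integral_rpow_mul_cexp hd h2]
      ring
    · exact (integrableOn_rpow_mul_cexp hd h1).const_mul _
    · exact (integrableOn_rpow_mul_cexp hd h2).const_mul _
  have hbρ : ∀ ρ : ℝ, 0 < ρ → 0 < ((ρ : ℂ) * b).re := fun ρ hρ => by simpa using mul_pos hρ hb
  have ht : ∀ ρ : ℝ, 0 < ρ → ∫ t, F t ρ ∂μ = ((ρ ^ (-1 - s) * (1 - rexp (-ρ)) : ℝ) : ℂ) *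
      (Real.Gamma (d + s) * b ^ (-((d + s : ℝ) : ℂ))) := by
    intro ρ hρ
    simp only [hF']
    rw [integral_const_mul, integral_rpow_mul_cexp (by linarith) (hbρ ρ hρ),
      ofReal_mul_cpow hρ hb, ← Complex.ofReal_neg, ← Complex.ofReal_cpow hρ.le,
      show -1 - s = (d - 1) + -(d + s) by ring, rpow_add hρ (d - 1)]
    push_cast
    ring
  have hmeas : Measurable (Function.uncurry F) := by
    have : Function.uncurry F = fun p : ℝ × ℝ => ((p.1 ^ (d + s - 1) : ℝ) : ℂ) *
      (((p.2 ^ (d - 1) : ℝ) : ℂ) *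
      (Complex.exp (-(p.2 * (p.1 * b))) - Complex.exp (-(p.2 * (1 + p.1 * b))))) := rfl
    rw [this]
    exact (Complex.measurable_ofReal.comp (measurable_fst.pow_const _)).mul
      ((Complex.measurable_ofReal.comp (measurable_snd.pow_const _)).mul (by fun_prop))
  have hint : Integrable (Function.uncurry F) (μ.prod μ) := by
    rw [integrable_prod_iff' hmeas.aestronglyMeasurable]
    constructor
    · filter_upwards [ae_restrict_mem measurableSet_Ioi] with ρ hρ
      simp only [Function.uncurry, hF']
      exact (integrableOn_rpow_mul_cexp (by linarith) (hbρ ρ hρ)).const_mul _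
    · refine ((integrableOn_rpow_mul_one_sub_exp hs hs1).mul_const
        (Real.Gamma (d + s) * b.re ^ (-(d + s)))).congr ?_
      filter_upwards [ae_restrict_mem measurableSet_Ioi] with ρ hρ
      have hρ : 0 < ρ := hρ
      have hρb := hbρ ρ hρ
      have h0 : 0 ≤ ρ ^ (d - 1) * (1 - rexp (-ρ)) :=
        mul_nonneg (by positivity) (one_sub_exp_neg_nonneg hρ.le)
      have : ∀ t ∈ Ioi (0 : ℝ), ‖Function.uncurry F (t, ρ)‖ = ρ ^ (d - 1) * (1 - rexp (-ρ)) *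
          (t ^ (d + s - 1) * rexp (-((ρ * b.re) * t))) := by
        intro t ht
        simp only [Function.uncurry, hF']
        rw [norm_mul, norm_rpow_mul_cexp ht, Complex.norm_real, Real.norm_of_nonneg h0]
        congr 3
        simp
        ring
      rw [setIntegral_congr_fun measurableSet_Ioi this, integral_const_mul,
        Real.integral_rpow_mul_exp_neg_mul_Ioi (by linarith) (by positivity), one_div,
        inv_rpow (by positivity), ← rpow_neg (by positivity), mul_rpow hρ.le hb.le,
        show -1 - s = (d - 1) + -(d + s) by ring, rpow_add hρ (d - 1)]
      ring
  have hswap := integral_integral_swap hint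
  have e1 : ∫ t, ∫ ρ, F t ρ ∂μ ∂μ = Real.Gamma d * ∫ t in Ioi (0 : ℝ),
      ((t ^ (d + s - 1) : ℝ) : ℂ) * ((t * b) ^ (-(d : ℂ)) - (1 + t * b) ^ (-(d : ℂ))) := by
    rw [← integral_const_mul]
    exact setIntegral_congr_fun measurableSet_Ioi fun t ht => hρ t ht
  have e2 : ∫ ρ, ∫ t, F t ρ ∂μ ∂μ = ((∫ ρ in Ioi (0 : ℝ), ρ ^ (-1 - s) * (1 - rexp (-ρ)) : ℝ) : ℂ) *
      (Real.Gamma (d + s) * b ^ (-((d + s : ℝ) : ℂ))) := by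
    rw [← integral_complex_ofReal, ← integral_mul_const]
    exact setIntegral_congr_fun measurableSet_Ioi fun ρ hρ => ht ρ hρ
  rw [e1, e2] at hswap
  have hG : (Real.Gamma d : ℂ) ≠ 0 := Complex.ofReal_ne_zero.2 (Real.Gamma_pos_of_pos hd).ne'
  rw [kerConst]
  push_cast at hswap ⊢
  field_simp
  linear_combination hswap

lemma norm_second_difference_le {g g' g'' : ℝ → ℂ} {M : ℝ} (h1 : ∀ τ, HasDerivAt g (g' τ) τ)
    (h2 : ∀ τ, HasDerivAt g' (g'' τ) τ) (hM : ∀ τ, ‖g'' τ‖ ≤ M) :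
    ‖2 * g 0 - g 1 - g (-1)‖ ≤ 2 * M := by
  have hM0 : 0 ≤ M := (norm_nonneg _).trans (hM 0)
  have hlip : ∀ a b, ‖g' b - g' a‖ ≤ M * ‖b - a‖ := fun a b =>
    Convex.norm_image_sub_le_of_norm_hasDerivWithin_le (s := univ)
      (fun x _ => (h2 x).hasDerivWithinAt) (fun x _ => hM x) convex_univ (mem_univ a) (mem_univ b)
  have hd : ∀ τ, HasDerivAt (fun τ => 2 * g 0 - g τ - g (-τ)) (0 - g' τ - (-1 : ℝ) • g' (-τ)) τ :=
    fun τ => ((hasDerivAt_const τ _).sub (h1 τ)).sub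
      (HasDerivAt.scomp τ (h1 (-τ)) (hasDerivAt_neg τ))
  have hb : ∀ τ ∈ Ico (0 : ℝ) 1, ‖0 - g' τ - (-1 : ℝ) • g' (-τ)‖ ≤ 2 * M := by
    intro τ hτ
    have e : 0 - g' τ - (-1 : ℝ) • g' (-τ) = g' (-τ) - g' τ := by simp; ring
    rw [e]
    refine (hlip _ _).trans ?_
    rw [show -τ - τ = -(2 * τ) by ring, norm_neg, Real.norm_of_nonneg (by linarith [hτ.1])]
    nlinarith [hτ.2]
  have := norm_image_sub_le_of_norm_deriv_le_segment_01'
    (fun τ _ => (hd τ).hasDerivWithinAt) hb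
  have e : (2 * g 0 - g 1 - g (-1)) - (2 * g 0 - g 0 - g (-0)) = 2 * g 0 - g 1 - g (-1) := by
    rw [neg_zero]; ring
  rw [e] at this
  exact this

lemma norm_add_smul_sq {E : Type*} [NormedAddCommGroup E] [InnerProductSpace ℝ E] (x z : E)
    (τ : ℝ) : ‖x + τ • z‖ ^ 2 = ‖x‖ ^ 2 + 2 * τ * ⟪x, z⟫ + τ ^ 2 * ‖z‖ ^ 2 := by
  rw [norm_add_sq_real, inner_smul_right, norm_smul, mul_pow, Real.norm_eq_abs, sq_abs]
  ring

lemma norm_radial_second_difference_le {E : Type*} [NormedAddCommGroup E] [InnerProductSpace ℝ E]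
    {f f' f'' : ℝ → ℂ} {M : ℝ} (h1 : ∀ u, 0 ≤ u → HasDerivAt f (f' u) u)
    (h2 : ∀ u, 0 ≤ u → HasDerivAt f' (f'' u) u)
    (hM : ∀ u, 0 ≤ u → 4 * u * ‖f'' u‖ + 2 * ‖f' u‖ ≤ M) (x z : E) :
    ‖2 * f (‖x‖ ^ 2) - f (‖x + z‖ ^ 2) - f (‖x - z‖ ^ 2)‖ ≤ 2 * M * ‖z‖ ^ 2 := by
  set ρ : ℝ → ℝ := fun τ => ‖x + τ • z‖ ^ 2 with hρ
  set ρ' : ℝ → ℝ := fun τ => 2 * ⟪x, z⟫ + 2 * τ * ‖z‖ ^ 2 with hρ'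
  have hρ0 : ∀ τ, 0 ≤ ρ τ := fun τ => by positivity
  have hd1 : ∀ τ, HasDerivAt ρ (ρ' τ) τ := by
    intro τ
    have : ρ = fun τ => ‖x‖ ^ 2 + 2 * τ * ⟪x, z⟫ + τ ^ 2 * ‖z‖ ^ 2 :=
      funext fun τ => norm_add_smul_sq x z τ
    rw [this]
    refine (((((hasDerivAt_id τ).const_mul 2).mul_const _).const_add _).add
      ((hasDerivAt_pow 2 τ).mul_const _)).congr_deriv ?_
    simp only [hρ']
    push_cast
    ring
  have hd2 : ∀ τ, HasDerivAt ρ' (2 * ‖z‖ ^ 2) τ := by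
    intro τ
    refine ((((hasDerivAt_id τ).const_mul 2).mul_const _).const_add _).congr_deriv ?_
    ring
  have hCS : ∀ τ, ρ' τ ^ 2 ≤ 4 * ρ τ * ‖z‖ ^ 2 := by
    intro τ
    have : ρ' τ = 2 * ⟪x + τ • z, z⟫ := by
      simp only [hρ']
      rw [inner_add_left, inner_smul_left, real_inner_self_eq_norm_sq]
      simp
      ring
    rw [this]
    have h := abs_real_inner_le_norm (x + τ • z) z
    have h' := abs_nonneg ⟪x + τ • z, z⟫
    have : ⟪x + τ • z, z⟫ ^ 2 ≤ (‖x + τ • z‖ * ‖z‖) ^ 2 := by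
      rw [← sq_abs]; exact pow_le_pow_left₀ h' h 2
    simp only [hρ]
    nlinarith
  have hM' : ∀ τ, ‖(2 * ‖z‖ ^ 2) • f' (ρ τ) + ρ' τ • ρ' τ • f'' (ρ τ)‖ ≤ M * ‖z‖ ^ 2 := by
    intro τ
    refine (norm_add_le _ _).trans ?_
    rw [← mul_smul, norm_smul, norm_smul, Real.norm_of_nonneg (by positivity),
      Real.norm_of_nonneg (mul_self_nonneg _), ← sq]
    have h := hM (ρ τ) (hρ0 τ)
    have h3 := mul_le_mul_of_nonneg_right (hCS τ) (norm_nonneg (f'' (ρ τ)))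
    have h4 := mul_le_mul_of_nonneg_right h (sq_nonneg ‖z‖)
    nlinarith
  have := norm_second_difference_le (g := fun τ => f (ρ τ)) (g' := fun τ => ρ' τ • f' (ρ τ))
    (g'' := fun τ => (2 * ‖z‖ ^ 2) • f' (ρ τ) + ρ' τ • ρ' τ • f'' (ρ τ))
    (fun τ => (h1 _ (hρ0 τ)).scomp τ (hd1 τ))
    (fun τ => ((hd2 τ).smul ((h2 _ (hρ0 τ)).scomp τ (hd1 τ))).congr_deriv
      (by rw [add_comm]; rfl)) hM'
  simp only [hρ, zero_smul, one_smul, neg_smul, add_zero, ← sub_eq_add_neg] at this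
  linarith

/-- The second difference of a radial complex Gaussian. -/
lemma norm_gaussian_second_difference_le {E : Type*} [NormedAddCommGroup E]
    [InnerProductSpace ℝ E] {ω : ℂ} (hω : 0 < ω.re) (hω1 : ‖ω‖ = 1) {r : ℝ} (hr : 0 ≤ r) (x z : E) :
    ‖2 * Complex.exp (-(r * ω * (‖x‖ ^ 2 : ℝ))) - Complex.exp (-(r * ω * (‖x + z‖ ^ 2 : ℝ)))
      - Complex.exp (-(r * ω * (‖x - z‖ ^ 2 : ℝ)))‖
      ≤ (8 / ω.re + 4) * (1 + r) * min 1 (‖z‖ ^ 2) := by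
  have hn : ∀ u : ℝ, ‖Complex.exp (-(r * ω * u))‖ = rexp (-(r * ω.re * u)) := by
    intro u
    rw [Complex.norm_exp]; simp
  have hn1 : ∀ u : ℝ, 0 ≤ u → ‖Complex.exp (-(r * ω * u))‖ ≤ 1 := by
    intro u hu
    rw [hn, Real.exp_le_one_iff]
    have : 0 ≤ r * ω.re * u := by positivity
    linarith
  have hd : ∀ u : ℝ, HasDerivAt (fun u : ℝ => Complex.exp (-(r * ω * u)))
      (Complex.exp (-(r * ω * u)) * -(r * ω)) u := by
    intro u
    have := (((hasDerivAt_id (u : ℂ)).const_mul (r * ω)).neg.cexp).comp_ofReal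
    simpa using this
  have hM : ∀ u : ℝ, 0 ≤ u → 4 * u * ‖Complex.exp (-(r * ω * u)) * -(r * ω) * -(r * ω)‖
      + 2 * ‖Complex.exp (-(r * ω * u)) * -(r * ω)‖ ≤ (4 / ω.re + 2) * r := by
    intro u hu
    have h1 := hn1 u hu
    simp only [norm_mul, norm_neg, Complex.norm_real, Real.norm_of_nonneg hr, hω1, mul_one]
    have h2 : (r * ω.re * u) * rexp (-(r * ω.re * u)) ≤ 1 := by
      have h3 := Real.add_one_le_exp (r * ω.re * u)
      have h4 := Real.exp_pos (r * ω.re * u)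
      rw [Real.exp_neg, mul_inv_le_iff₀ h4]
      linarith
    rw [← hn] at h2
    set e := ‖Complex.exp (-(r * ω * u))‖
    have h5 : u * r * e ≤ 1 / ω.re := by
      rw [le_div_iff₀ hω]; linarith
    have h6 := mul_le_mul_of_nonneg_right h5 hr
    have h7 := mul_le_mul_of_nonneg_right h1 hr
    calc 4 * u * (e * r * r) + 2 * (e * r) = 4 * (u * r * e * r) + 2 * (e * r) := by ring
      _ ≤ 4 * (1 / ω.re * r) + 2 * (1 * r) := by linarith
      _ = _ := by ring
  have hmain := norm_radial_second_difference_le (fun u _ => hd u)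
    (fun u _ => (hd u).mul_const (-(r * ω))) hM x z
  have hK : (8 / ω.re + 4) * r ≤ (8 / ω.re + 4) * (1 + r) :=
    mul_le_mul_of_nonneg_left (by linarith) (by positivity)
  rcases le_total (‖z‖ ^ 2) 1 with h | h
  · rw [min_eq_right h]
    refine hmain.trans (mul_le_mul_of_nonneg_right ?_ (by positivity))
    refine le_trans (le_of_eq ?_) hK
    ring
  · rw [min_eq_left h, mul_one]
    have h4 : (4 : ℝ) ≤ (8 / ω.re + 4) * (1 + r) := by
      have : 0 ≤ 8 / ω.re := by positivity
      nlinarith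
    refine le_trans ?_ h4
    refine (norm_sub_le _ _).trans ((add_le_add_left (norm_sub_le _ _) _).trans ?_)
    rw [norm_mul]
    have a1 := hn1 (‖x‖ ^ 2) (by positivity)
    have a2 := hn1 (‖x + z‖ ^ 2) (by positivity)
    have a3 := hn1 (‖x - z‖ ^ 2) (by positivity)
    simp only [Complex.norm_ofNat]
    linarith

lemma integrable_min_norm_rpow {n : ℕ} {s σ : ℝ} (hn : 1 ≤ n) (hs : 0 < s) (hσ : 2 * s < σ) :
    Integrable (fun z : Spc n => min 1 (‖z‖ ^ σ) * ‖z‖ ^ (-(n : ℝ) - 2 * s)) := by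
  have : Nonempty (Fin n) := ⟨⟨0, hn⟩⟩
  have hm : Measurable (fun y : ℝ => y ^ (n - 1) • (min 1 (y ^ σ) * y ^ (-(n : ℝ) - 2 * s))) :=
    (measurable_id.pow_const _).smul ((measurable_const.min (measurable_id.pow_const _)).mul
      (measurable_id.pow_const _))
  have he : ∀ y : ℝ, 0 < y → y ^ (n - 1) * y ^ (-(n : ℝ) - 2 * s) = y ^ (-1 - 2 * s) := by
    intro y hy
    rw [← rpow_natCast, ← rpow_add hy, Nat.cast_sub hn]
    congr 1
    push_cast
    ring
  rw [integrable_fun_norm_addHaar (volume : Measure (Spc n))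
    (f := fun y => min 1 (y ^ σ) * y ^ (-(n : ℝ) - 2 * s)), finrank_euclideanSpace_fin,
    ← Ioc_union_Ioi_eq_Ioi zero_le_one]
  refine IntegrableOn.union ?_ ?_
  · have h1 : IntegrableOn (fun y : ℝ => y ^ (σ + (-1 - 2 * s))) (Ioc 0 1) := by
      rw [← intervalIntegrable_iff_integrableOn_Ioc_of_le zero_le_one]
      exact intervalIntegral.intervalIntegrable_rpow' (by linarith)
    refine Integrable.mono' h1 hm.aestronglyMeasurable ?_
    filter_upwards [ae_restrict_mem measurableSet_Ioc] with y hy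
    have h0 : 0 < y := hy.1
    rw [Real.norm_of_nonneg (by positivity), rpow_add h0, ← he y h0, smul_eq_mul]
    have : min 1 (y ^ σ) ≤ y ^ σ := min_le_right _ _
    calc y ^ (n - 1) * (min 1 (y ^ σ) * y ^ (-(n : ℝ) - 2 * s))
        ≤ y ^ (n - 1) * (y ^ σ * y ^ (-(n : ℝ) - 2 * s)) := by gcongr
      _ = _ := by ring
  · refine Integrable.mono' (integrableOn_Ioi_rpow_of_lt (by linarith : -1 - 2 * s < -1) one_pos)
      hm.aestronglyMeasurable ?_
    filter_upwards [ae_restrict_mem measurableSet_Ioi] with y hy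
    have h0 : 0 < y := lt_trans one_pos hy
    rw [Real.norm_of_nonneg (by positivity), ← he y h0, smul_eq_mul]
    have : min 1 (y ^ σ) ≤ 1 := min_le_left _ _
    calc y ^ (n - 1) * (min 1 (y ^ σ) * y ^ (-(n : ℝ) - 2 * s))
        ≤ y ^ (n - 1) * (1 * y ^ (-(n : ℝ) - 2 * s)) := by gcongr
      _ = _ := by ring

/-- Gaussian integrals against a translated complex Gaussian. -/
lemma integral_gaussian_mul_gaussian {n : ℕ} {ω : ℂ} {r t : ℝ} (hω : 0 < ω.re) (hr : 0 < r)
    (ht : 0 ≤ t) (x : Spc n) (ε : ℝ) (hε : ε ^ 2 = 1) :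
    Integrable (fun z : Spc n => Complex.exp (-(r * ω * (‖x + ε • z‖ ^ 2 : ℝ))) *
      Complex.exp (-(r * t * (‖z‖ ^ 2 : ℝ)))) ∧
    ∫ z : Spc n, Complex.exp (-(r * ω * (‖x + ε • z‖ ^ 2 : ℝ))) *
      Complex.exp (-(r * t * (‖z‖ ^ 2 : ℝ)))
      = ((π / r : ℝ) : ℂ) ^ ((n / 2 : ℝ) : ℂ) * (t + ω) ^ (-((n / 2 : ℝ) : ℂ)) *
        Complex.exp (-(r * (ω * (‖x‖ ^ 2 : ℝ) * t / (t + ω)))) := by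
  have htω : 0 < (t + ω).re := by
    rw [Complex.add_re, Complex.ofReal_re]; linarith
  have htω0 : (t + ω) ≠ 0 := fun h => by simp [h] at htω
  have hr0 : (r : ℂ) ≠ 0 := Complex.ofReal_ne_zero.2 hr.ne'
  have hb : 0 < ((r : ℂ) * (t + ω)).re := by
    rw [Complex.re_ofReal_mul]; positivity
  have hε' : (ε : ℂ) ^ 2 = 1 := by exact_mod_cast hε
  have e : ∀ z : Spc n, Complex.exp (-(r * ω * (‖x + ε • z‖ ^ 2 : ℝ))) *
      Complex.exp (-(r * t * (‖z‖ ^ 2 : ℝ))) = Complex.exp (-(r * ω * (‖x‖ ^ 2 : ℝ))) *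
      Complex.exp (-((r : ℂ) * (t + ω)) * ‖z‖ ^ 2 + (-2 * r * ω * ε) * ⟪x, z⟫) := by
    intro z
    rw [← Complex.exp_add, ← Complex.exp_add, norm_add_smul_sq]
    congr 1
    push_cast
    linear_combination (-(r : ℂ) * ω * ‖z‖ ^ 2) * hε'
  simp only [e]
  refine ⟨(GaussianFourier.integrable_cexp_neg_mul_sq_norm_add hb _ x).const_mul _, ?_⟩
  rw [integral_const_mul, GaussianFourier.integral_cexp_neg_mul_sq_norm_add hb,
    finrank_euclideanSpace_fin]
  have hinv : 0 < ((t + ω)⁻¹).re := by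
    rw [Complex.inv_re]
    exact div_pos htω (Complex.normSq_pos.2 htω0)
  have harg : (t + ω).arg ≠ π := Complex.mem_slitPlane_iff_arg.1 (Or.inl htω) |>.1
  have e2 : (π / (r * (t + ω)) : ℂ) = ((π / r : ℝ) : ℂ) * (t + ω)⁻¹ := by
    push_cast; field_simp
  have e3 : ((n : ℂ) / 2) = ((n / 2 : ℝ) : ℂ) := by push_cast; rfl
  rw [e2, e3, ofReal_mul_cpow (div_pos pi_pos hr) hinv, Complex.inv_cpow _ _ harg,
    ← Complex.cpow_neg]
  rw [mul_comm, mul_assoc, ← Complex.exp_add]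
  congr 2
  push_cast
  field_simp
  linear_combination (ω ^ 2 * ‖x‖ ^ 2 * 4) * hε'

lemma integral_integral_integral_reverse {α β γ : Type*} [MeasurableSpace α] [MeasurableSpace β]
    [MeasurableSpace γ] {μ : Measure α} {ν : Measure β} {τ : Measure γ} [SFinite μ] [SFinite ν]
    [SFinite τ] {f : α → β → γ → ℂ}
    (hf : Integrable (fun p : (α × β) × γ => f p.1.1 p.1.2 p.2) ((μ.prod ν).prod τ)) :
    ∫ x, ∫ y, ∫ z, f x y z ∂τ ∂ν ∂μ = ∫ z, ∫ y, ∫ x, f x y z ∂μ ∂ν ∂τ := by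
  have h1 := integral_prod _ hf
  have h2 := integral_prod _ hf.integral_prod_left
  have hmp := (measurePreserving_prodAssoc μ ν τ).symm
  have hg : Integrable (fun p : α × β × γ => f p.1 p.2.1 p.2.2) (μ.prod (ν.prod τ)) :=
    (hmp.integrable_comp_emb (MeasurableEquiv.measurableEmbedding _)).2 hf
  have h3 : ∫ p : α × β × γ, f p.1 p.2.1 p.2.2 ∂(μ.prod (ν.prod τ)) =
      ∫ p : (α × β) × γ, f p.1.1 p.1.2 p.2 ∂((μ.prod ν).prod τ) :=
    hmp.integral_comp (MeasurableEquiv.measurableEmbedding _)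
      (fun p : (α × β) × γ => f p.1.1 p.1.2 p.2)
  have h4 := integral_prod_symm _ hg
  have h5 := integral_prod_symm _ hg.integral_prod_right
  rw [← h2, ← h1, ← h3, h4, h5]

lemma integral_sub_sub {α : Type*} [MeasurableSpace α] {μ : Measure α} {f g h : α → ℂ}
    (hf : Integrable f μ) (hg : Integrable g μ) (hh : Integrable h μ) :
    ∫ x, (f x - g x - h x) ∂μ = ∫ x, f x ∂μ - ∫ x, g x ∂μ - ∫ x, h x ∂μ := by
  rw [← integral_sub hf hg]
  exact integral_sub (hf.sub hg) hh

/-- The second difference of a radial complex Gaussian, with weights. -/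
def gaussDiff {n : ℕ} (β : ℝ) (ω ω' : ℂ) (x z : Spc n) (r : ℝ) : ℂ :=
  ((r ^ (β - 1) : ℝ) : ℂ) * Complex.exp (-(r * ω')) *
    (2 * Complex.exp (-(r * ω * (‖x‖ ^ 2 : ℝ))) - Complex.exp (-(r * ω * (‖x + z‖ ^ 2 : ℝ)))
      - Complex.exp (-(r * ω * (‖x - z‖ ^ 2 : ℝ))))

lemma norm_gaussDiff_le {n : ℕ} {β : ℝ} {ω ω' : ℂ} (hω : 0 < ω.re) (hω1 : ‖ω‖ = 1) {r : ℝ}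
    (hr : 0 < r) (x z : Spc n) :
    ‖gaussDiff β ω ω' x z r‖ ≤ (8 / ω.re + 4) *
      (r ^ (β - 1) * rexp (-(r * ω'.re)) + r ^ (β + 1 - 1) * rexp (-(r * ω'.re))) *
      min 1 (‖z‖ ^ 2) := by
  rw [gaussDiff, norm_mul, norm_rpow_mul_cexp hr, add_sub_right_comm, rpow_add_one hr.ne']
  calc _ ≤ r ^ (β - 1) * rexp (-(r * ω'.re)) * ((8 / ω.re + 4) * (1 + r) * min 1 (‖z‖ ^ 2)) :=
        mul_le_mul_of_nonneg_left (norm_gaussian_second_difference_le hω hω1 hr.le x z)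
          (by positivity)
    _ = _ := by ring

lemma measurable_gaussDiff {n : ℕ} (β : ℝ) (ω ω' : ℂ) (x : Spc n) :
    Measurable (fun p : Spc n × ℝ => gaussDiff β ω ω' x p.1 p.2) := by
  unfold gaussDiff
  exact ((Complex.measurable_ofReal.comp (measurable_snd.pow_const _)).mul (by fun_prop)).mul
    (by fun_prop)

lemma integral_gaussDiff {n : ℕ} {β : ℝ} {ω ω' : ℂ} (hβ : 0 < β) (hω : 0 < ω.re)
    (hω' : 0 < ω'.re) (x z : Spc n) :
    ∫ r in Ioi (0 : ℝ), gaussDiff β ω ω' x z r = Real.Gamma β *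
      (2 * (ω' + ω * (‖x‖ ^ 2 : ℝ)) ^ (-(β : ℂ)) - (ω' + ω * (‖x + z‖ ^ 2 : ℝ)) ^ (-(β : ℂ))
        - (ω' + ω * (‖x - z‖ ^ 2 : ℝ)) ^ (-(β : ℂ))) := by
  have hre : ∀ u : ℝ, 0 ≤ u → 0 < (ω' + ω * u).re := by
    intro u hu
    rw [Complex.add_re, mul_comm, Complex.re_ofReal_mul]
    positivity
  have e : ∀ r : ℝ, gaussDiff β ω ω' x z r =
      2 * (((r ^ (β - 1) : ℝ) : ℂ) * Complex.exp (-(r * (ω' + ω * (‖x‖ ^ 2 : ℝ))))) -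
      ((r ^ (β - 1) : ℝ) : ℂ) * Complex.exp (-(r * (ω' + ω * (‖x + z‖ ^ 2 : ℝ)))) -
      ((r ^ (β - 1) : ℝ) : ℂ) * Complex.exp (-(r * (ω' + ω * (‖x - z‖ ^ 2 : ℝ)))) := by
    intro r
    have : ∀ u : ℝ, Complex.exp (-(r * (ω' + ω * u)))
        = Complex.exp (-(r * ω')) * Complex.exp (-(r * ω * u)) := by
      intro u; rw [← Complex.exp_add]; congr 1; ring
    rw [gaussDiff, this, this, this]
    ring
  have i1 := integrableOn_rpow_mul_cexp hβ (hre (‖x‖ ^ 2) (by positivity))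
  have i2 := integrableOn_rpow_mul_cexp hβ (hre (‖x + z‖ ^ 2) (by positivity))
  have i3 := integrableOn_rpow_mul_cexp hβ (hre (‖x - z‖ ^ 2) (by positivity))
  simp only [e]
  rw [integral_sub_sub (i1.const_mul 2) i2 i3,
    integral_const_mul, integral_rpow_mul_cexp hβ (hre (‖x‖ ^ 2) (by positivity)),
    integral_rpow_mul_cexp hβ (hre (‖x + z‖ ^ 2) (by positivity)),
    integral_rpow_mul_cexp hβ (hre (‖x - z‖ ^ 2) (by positivity))]
  ring

lemma integral_gaussDiff_mul {n : ℕ} {β : ℝ} {ω ω' : ℂ} {r t : ℝ} (hω : 0 < ω.re)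
    (hωω' : ω * ω' = 1) (hr : 0 < r) (ht : 0 < t) (x : Spc n) :
    ∫ z : Spc n, gaussDiff β ω ω' x z r * Complex.exp (-(r * t * (‖z‖ ^ 2 : ℝ)))
      = 2 * ((π / r : ℝ) : ℂ) ^ ((n / 2 : ℝ) : ℂ) * ((r ^ (β - 1) : ℝ) : ℂ) *
        ((t : ℂ) ^ (-((n / 2 : ℝ) : ℂ)) * Complex.exp (-(r * (ω' + ω * (‖x‖ ^ 2 : ℝ))))
        - (t + ω) ^ (-((n / 2 : ℝ) : ℂ)) *
          Complex.exp (-(r * ((1 + t * (ω' + ω * (‖x‖ ^ 2 : ℝ))) / (t + ω))))) := by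
  have htω0 : (t + ω) ≠ 0 := fun h => by
    have := congrArg Complex.re h
    simp at this
    linarith
  obtain ⟨i1, h1⟩ := integral_gaussian_mul_gaussian hω hr ht.le x 1 (by norm_num)
  obtain ⟨i2, h2⟩ := integral_gaussian_mul_gaussian hω hr ht.le x (-1) (by norm_num)
  simp only [one_smul, neg_smul, ← sub_eq_add_neg] at i1 h1 i2 h2
  have hrt : 0 < r * t := mul_pos hr ht
  have i0 : Integrable (fun z : Spc n => Complex.exp (-(r * t * (‖z‖ ^ 2 : ℝ)))) := by
    have := GaussianFourier.integrable_cexp_neg_mul_sq_norm_add (V := Spc n) (b := r * t)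
      (by simpa using hrt) 0 0
    refine this.congr (Eventually.of_forall fun z => ?_)
    simp
  have h0 : ∫ z : Spc n, Complex.exp (-(r * t * (‖z‖ ^ 2 : ℝ)))
      = ((π / r : ℝ) : ℂ) ^ ((n / 2 : ℝ) : ℂ) * (t : ℂ) ^ (-((n / 2 : ℝ) : ℂ)) := by
    have := GaussianFourier.integral_cexp_neg_mul_sq_norm (V := Spc n) (b := r * t)
      (by simpa using hrt)
    rw [finrank_euclideanSpace_fin] at this
    push_cast
    simp only [neg_mul] at this
    rw [this, show (π / (r * t) : ℂ) = ((π / r : ℝ) : ℂ) * ((t⁻¹ : ℝ) : ℂ) by push_cast; field_simp,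
      Complex.mul_cpow_ofReal_nonneg (by positivity) (by positivity), Complex.ofReal_inv,
      Complex.inv_cpow _ _ (by rw [Complex.arg_ofReal_of_nonneg ht.le]; exact pi_pos.ne),
      ← Complex.cpow_neg]
    push_cast
    rfl
  have e : ∀ z : Spc n, gaussDiff β ω ω' x z r * Complex.exp (-(r * t * (‖z‖ ^ 2 : ℝ)))
      = ((r ^ (β - 1) : ℝ) : ℂ) * Complex.exp (-(r * ω')) *
      (2 * Complex.exp (-(r * ω * (‖x‖ ^ 2 : ℝ))) * Complex.exp (-(r * t * (‖z‖ ^ 2 : ℝ)))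
      - Complex.exp (-(r * ω * (‖x + z‖ ^ 2 : ℝ))) * Complex.exp (-(r * t * (‖z‖ ^ 2 : ℝ)))
      - Complex.exp (-(r * ω * (‖x - z‖ ^ 2 : ℝ))) * Complex.exp (-(r * t * (‖z‖ ^ 2 : ℝ)))) := by
    intro z
    rw [gaussDiff]
    ring
  simp only [e]
  rw [integral_const_mul, integral_sub_sub (i0.const_mul _) i1 i2, integral_const_mul, h0, h1, h2]
  have e1 : Complex.exp (-(r * (ω' + ω * (‖x‖ ^ 2 : ℝ))))
      = Complex.exp (-(r * ω')) * Complex.exp (-(r * ω * (‖x‖ ^ 2 : ℝ))) := by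
    rw [← Complex.exp_add]; congr 1; ring
  have e2 : Complex.exp (-(r * ((1 + t * (ω' + ω * (‖x‖ ^ 2 : ℝ))) / (t + ω))))
      = Complex.exp (-(r * ω')) * Complex.exp (-(r * (ω * (‖x‖ ^ 2 : ℝ) * t / (t + ω)))) := by
    have h : (1 + t * (ω' + ω * (‖x‖ ^ 2 : ℝ))) / (t + ω)
        = ω' + ω * (‖x‖ ^ 2 : ℝ) * t / (t + ω) := by
      rw [div_eq_iff htω0, add_mul, div_mul_cancel₀ _ htω0]
      linear_combination -hωω'
    rw [← Complex.exp_add, h]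
    congr 1
    ring
  rw [e1, e2]
  ring

/-- The heat kernel weight in the subordination formula for `‖z‖ ^ (-2 * p)`. -/
def heatWeight (p ρ r t : ℝ) : ℝ := r ^ p * (t ^ (p - 1) * rexp (-(r * t * ρ ^ 2)))

lemma heatWeight_nonneg {p ρ r t : ℝ} (hr : 0 < r) (ht : 0 < t) : 0 ≤ heatWeight p ρ r t := by
  unfold heatWeight; positivity

lemma integrableOn_heatWeight {p ρ r : ℝ} (hp : 0 < p) (hρ : 0 < ρ) (hr : 0 < r) :
    IntegrableOn (heatWeight p ρ r) (Ioi 0) := by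
  have := (integrableOn_rpow_mul_exp hp (c := r * ρ ^ 2) (by positivity)).const_mul (r ^ p)
  refine this.congr (Eventually.of_forall fun t => ?_)
  simp only [heatWeight]
  rw [show t * (r * ρ ^ 2) = r * t * ρ ^ 2 by ring]

lemma integral_heatWeight {p ρ r : ℝ} (hp : 0 < p) (hρ : 0 < ρ) (hr : 0 < r) :
    ∫ t in Ioi (0 : ℝ), heatWeight p ρ r t = Real.Gamma p * ρ ^ (-(2 * p)) := by
  have h := Real.integral_rpow_mul_exp_neg_mul_Ioi hp (r := r * ρ ^ 2) (by positivity)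
  have e : ∀ t, heatWeight p ρ r t = r ^ p * (t ^ (p - 1) * rexp (-(r * ρ ^ 2 * t))) := by
    intro t
    rw [heatWeight, show r * t * ρ ^ 2 = r * ρ ^ 2 * t by ring]
  simp only [e]
  rw [integral_const_mul, h, one_div, inv_rpow (by positivity), mul_rpow hr.le (by positivity),
    ← rpow_natCast_mul hρ.le, rpow_neg hρ.le]
  push_cast
  field_simp

lemma measurable_heatWeight (p : ℝ) :
    Measurable (fun q : (ℝ × ℝ) × ℝ => heatWeight p q.1.1 q.1.2 q.2) := by
  unfold heatWeight
  fun_prop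

lemma gaussDiff_zero {n : ℕ} (β : ℝ) (ω ω' : ℂ) (x : Spc n) (r : ℝ) :
    gaussDiff β ω ω' x 0 r = 0 := by
  simp only [gaussDiff, add_zero, sub_zero]
  ring

lemma integral_gaussDiff_mul_heatWeight {n : ℕ} {β p : ℝ} {ω ω' : ℂ} (hp : 0 < p) (x z : Spc n)
    {r : ℝ} (hr : 0 < r) :
    ∫ t in Ioi (0 : ℝ), gaussDiff β ω ω' x z r * (heatWeight p ‖z‖ r t : ℂ)
      = Real.Gamma p * (gaussDiff β ω ω' x z r * ((‖z‖ ^ (-(2 * p)) : ℝ) : ℂ)) := by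
  rcases eq_or_ne z 0 with rfl | hz
  · simp [gaussDiff_zero]
  rw [integral_const_mul, integral_complex_ofReal, integral_heatWeight hp (norm_pos_iff.2 hz) hr]
  push_cast
  ring

lemma integrable_gaussDiff_mul_heatWeight {n : ℕ} {β s : ℝ} {ω ω' : ℂ} (hn : 1 ≤ n)
    (hs : 0 < s) (hs1 : s < 1) (hβ : 0 < β) (hω : 0 < ω.re) (hω1 : ‖ω‖ = 1) (hω' : 0 < ω'.re)
    (x : Spc n) :
    Integrable (fun q : (Spc n × ℝ) × ℝ => gaussDiff β ω ω' x q.1.1 q.1.2 *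
      (heatWeight (n / 2 + s) ‖q.1.1‖ q.1.2 q.2 : ℂ))
      (((volume : Measure (Spc n)).prod (volume.restrict (Ioi 0))).prod
        (volume.restrict (Ioi 0))) := by
  have hp : 0 < (n / 2 + s : ℝ) := by positivity
  have hmeas : Measurable (fun q : (Spc n × ℝ) × ℝ => gaussDiff β ω ω' x q.1.1 q.1.2 *
      (heatWeight (n / 2 + s) ‖q.1.1‖ q.1.2 q.2 : ℂ)) :=
    ((measurable_gaussDiff β ω ω' x).comp measurable_fst).mul
      (Complex.measurable_ofReal.comp ((measurable_heatWeight (n / 2 + s)).comp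
        (f := fun q : (Spc n × ℝ) × ℝ => ((‖q.1.1‖, q.1.2), q.2)) (by fun_prop)))
  have hpos : ∀ᵐ q : Spc n × ℝ ∂((volume : Measure (Spc n)).prod (volume.restrict (Ioi 0))),
      0 < q.2 :=
    Measure.quasiMeasurePreserving_snd.ae (p := fun r : ℝ => 0 < r)
      (ae_restrict_mem measurableSet_Ioi)
  refine (integrable_prod_iff hmeas.aestronglyMeasurable).2 ⟨?_, ?_⟩
  · filter_upwards [hpos] with q hq
    rcases eq_or_ne q.1 0 with hz | hz
    · simp [hz, gaussDiff_zero]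
    · exact ((integrableOn_heatWeight hp (norm_pos_iff.2 hz) hq).ofReal).const_mul _
  · have hb : Integrable (fun q : Spc n × ℝ =>
        (min 1 (‖q.1‖ ^ (2 : ℝ)) * ‖q.1‖ ^ (-(n : ℝ) - 2 * s)) *
        (Real.Gamma (n / 2 + s) * ((8 / ω.re + 4) *
          (q.2 ^ (β - 1) * rexp (-(q.2 * ω'.re)) + q.2 ^ (β + 1 - 1) * rexp (-(q.2 * ω'.re))))))
        ((volume : Measure (Spc n)).prod (volume.restrict (Ioi 0))) :=
      (integrable_min_norm_rpow hn hs (by linarith)).mul_prod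
        ((((integrableOn_rpow_mul_exp hβ hω').add
          (integrableOn_rpow_mul_exp (by linarith) hω')).const_mul _).const_mul _)
    refine Integrable.mono' hb
      (hmeas.norm.stronglyMeasurable.integral_prod_right'.aestronglyMeasurable) ?_
    filter_upwards [hpos] with q hq
    have hG := Real.Gamma_pos_of_pos hp
    rw [Real.norm_of_nonneg (integral_nonneg fun _ => norm_nonneg _)]
    have e : ∫ t in Ioi (0 : ℝ), ‖gaussDiff β ω ω' x q.1 q.2 *
        (heatWeight (n / 2 + s) ‖q.1‖ q.2 t : ℂ)‖ = ‖gaussDiff β ω ω' x q.1 q.2‖ *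
          (Real.Gamma (n / 2 + s) * ‖q.1‖ ^ (-(n : ℝ) - 2 * s)) := by
      rcases eq_or_ne q.1 0 with hz | hz
      · simp [hz, gaussDiff_zero]
      · rw [show -(n : ℝ) - 2 * s = -(2 * (n / 2 + s)) by ring,
          ← integral_heatWeight hp (norm_pos_iff.2 hz) hq, ← integral_const_mul]
        refine setIntegral_congr_fun measurableSet_Ioi fun t ht => ?_
        simp only [norm_mul, Complex.norm_real]
        rw [Real.norm_of_nonneg (heatWeight_nonneg hq ht)]
    rw [e]
    have h := norm_gaussDiff_le (β := β) (ω' := ω') hω hω1 hq x q.1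
    have hk : 0 ≤ Real.Gamma (n / 2 + s) * ‖q.1‖ ^ (-(n : ℝ) - 2 * s) := by positivity
    refine (mul_le_mul_of_nonneg_right h hk).trans (le_of_eq ?_)
    rw [rpow_two]
    ring

/-- The eigenvalue-like constant in the action of the fractional Laplacian on complex bubbles. -/
def bubConst (d s : ℝ) : ℝ :=
  2 * π ^ d * Real.Gamma d * kerConst d s / (Real.Gamma (d - s) * Real.Gamma (d + s))

lemma bubConst_pos {d s : ℝ} (hs : 0 < s) (hs1 : s < 1) (hsd : s < d) : 0 < bubConst d s := by
  have h1 := Real.Gamma_pos_of_pos (show 0 < d by linarith)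
  have h2 := Real.Gamma_pos_of_pos (show 0 < d - s by linarith)
  have h3 := Real.Gamma_pos_of_pos (show 0 < d + s by linarith)
  have h4 := kerConst_pos (show 0 < d by linarith) hs hs1
  unfold bubConst
  positivity

lemma integral_gaussDiff_mul_heatWeight_space {n : ℕ} {s : ℝ} {ω ω' : ℂ} {r t : ℝ}
    (hω : 0 < ω.re) (hωω' : ω * ω' = 1) (hr : 0 < r) (ht : 0 < t) (x : Spc n) :
    ∫ z : Spc n, gaussDiff (n / 2 - s) ω ω' x z r * (heatWeight (n / 2 + s) ‖z‖ r t : ℂ)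
      = 2 * ((π ^ (n / 2 : ℝ) : ℝ) : ℂ) * ((t ^ (n / 2 + s - 1 : ℝ) : ℝ) : ℂ) *
        ((t : ℂ) ^ (-((n / 2 : ℝ) : ℂ)) * (((r ^ (n / 2 - 1 : ℝ) : ℝ) : ℂ) *
            Complex.exp (-(r * (ω' + ω * (‖x‖ ^ 2 : ℝ)))))
        - (t + ω) ^ (-((n / 2 : ℝ) : ℂ)) * (((r ^ (n / 2 - 1 : ℝ) : ℝ) : ℂ) *
          Complex.exp (-(r * ((1 + t * (ω' + ω * (‖x‖ ^ 2 : ℝ))) / (t + ω)))))) := by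
  have h := integral_gaussDiff_mul (β := n / 2 - s) hω hωω' hr ht x
  have e : ∀ z : Spc n, gaussDiff (n / 2 - s) ω ω' x z r * (heatWeight (n / 2 + s) ‖z‖ r t : ℂ)
      = ((r ^ (n / 2 + s : ℝ) * t ^ (n / 2 + s - 1 : ℝ) : ℝ) : ℂ) *
        (gaussDiff (n / 2 - s) ω ω' x z r * Complex.exp (-(r * t * (‖z‖ ^ 2 : ℝ)))) := by
    intro z
    rw [heatWeight]
    push_cast
    ring
  simp only [e]
  rw [integral_const_mul, h, ← Complex.ofReal_cpow (by positivity)]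
  have hpow : r ^ (n / 2 + s : ℝ) * (π / r) ^ (n / 2 : ℝ) * r ^ (n / 2 - s - 1 : ℝ)
      = π ^ (n / 2 : ℝ) * r ^ (n / 2 - 1 : ℝ) := by
    have hinv : (r ^ (n / 2 : ℝ))⁻¹ = r ^ (-(n / 2) : ℝ) := (rpow_neg hr.le _).symm
    rw [div_rpow pi_pos.le hr.le, div_eq_mul_inv (π ^ (n / 2 : ℝ)), hinv]
    calc _ = π ^ (n / 2 : ℝ) * (r ^ (n / 2 + s : ℝ) * r ^ (-(n / 2) : ℝ) *
          r ^ (n / 2 - s - 1 : ℝ)) := by ring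
      _ = _ := by
          rw [← rpow_add hr, ← rpow_add hr]
          congr 2
          ring
  have hpow' := congrArg (fun y : ℝ => (y : ℂ)) hpow
  simp only [Complex.ofReal_mul] at hpow' ⊢
  linear_combination (2 * ((t ^ (n / 2 + s - 1 : ℝ) : ℝ) : ℂ) *
    ((t : ℂ) ^ (-((n / 2 : ℝ) : ℂ)) * Complex.exp (-(r * (ω' + ω * (‖x‖ ^ 2 : ℝ))))
        - (t + ω) ^ (-((n / 2 : ℝ) : ℂ)) *
          Complex.exp (-(r * ((1 + t * (ω' + ω * (‖x‖ ^ 2 : ℝ))) / (t + ω)))))) * hpow'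

lemma re_moebius_pos {ω ω' : ℂ} {t u : ℝ} (hω : 0 < ω.re) (hω' : 0 < ω'.re) (hωω' : ω * ω' = 1)
    (ht : 0 < t) (hu : 0 ≤ u) : 0 < ((1 + t * (ω' + ω * u)) / (t + ω)).re := by
  have hre : 0 < ((t : ℂ) + ω).re := by
    rw [Complex.add_re, Complex.ofReal_re]; positivity
  have htω0 : ((t : ℂ) + ω) ≠ 0 := fun h => by simp [h] at hre
  have h : (1 + t * (ω' + ω * u)) / (t + ω) = ω' + ((t * u : ℝ) : ℂ) * (ω / (t + ω)) := by
    rw [div_eq_iff htω0, add_mul, mul_assoc, div_mul_cancel₀ _ htω0]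
    push_cast
    linear_combination -hωω'
  rw [h, Complex.add_re, Complex.re_ofReal_mul]
  have : 0 ≤ (ω / (t + ω)).re := by
    rw [Complex.div_re]
    simp only [Complex.add_re, Complex.ofReal_re, Complex.add_im, Complex.ofReal_im, zero_add]
    have := Complex.normSq_nonneg ((t : ℂ) + ω)
    have := mul_self_nonneg ω.im
    have := hω.le
    positivity
  positivity

/-- The fractional Laplacian maps a complex bubble to a multiple of its conformal dual. -/
lemma integral_bubble_second_difference {n : ℕ} {s : ℝ} {ω ω' : ℂ} (hn : 1 ≤ n) (hs : 0 < s)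
    (hs1 : s < 1) (hsn : s < n / 2) (hω : 0 < ω.re) (hω1 : ‖ω‖ = 1) (hω' : 0 < ω'.re)
    (hωω' : ω * ω' = 1) (x : Spc n) :
    ∫ z : Spc n, (2 * (ω' + ω * (‖x‖ ^ 2 : ℝ)) ^ (-((n / 2 - s : ℝ) : ℂ))
        - (ω' + ω * (‖x + z‖ ^ 2 : ℝ)) ^ (-((n / 2 - s : ℝ) : ℂ))
        - (ω' + ω * (‖x - z‖ ^ 2 : ℝ)) ^ (-((n / 2 - s : ℝ) : ℂ))) *
        ((‖z‖ ^ (-(n : ℝ) - 2 * s) : ℝ) : ℂ)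
      = bubConst (n / 2) s * (ω' + ω * (‖x‖ ^ 2 : ℝ)) ^ (-((n / 2 + s : ℝ) : ℂ)) := by
  have hd : (0 : ℝ) < n / 2 := by linarith
  have hp : (0 : ℝ) < n / 2 + s := by linarith
  have hβ : (0 : ℝ) < n / 2 - s := by linarith
  set b : ℂ := ω' + ω * (‖x‖ ^ 2 : ℝ) with hbdef
  have hb : 0 < b.re := by
    rw [hbdef, Complex.add_re, mul_comm, Complex.re_ofReal_mul]; positivity
  have hrev := integral_integral_integral_reverse
    (f := fun z r t => gaussDiff (n / 2 - s) ω ω' x z r * (heatWeight (n / 2 + s) ‖z‖ r t : ℂ))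
    (integrable_gaussDiff_mul_heatWeight hn hs hs1 hβ hω hω1 hω' x)
  have hleft : ∀ z : Spc n, ∫ r in Ioi (0 : ℝ), ∫ t in Ioi (0 : ℝ),
      gaussDiff (n / 2 - s) ω ω' x z r * (heatWeight (n / 2 + s) ‖z‖ r t : ℂ)
      = Real.Gamma (n / 2 + s) * Real.Gamma (n / 2 - s) *
        ((2 * b ^ (-((n / 2 - s : ℝ) : ℂ))
        - (ω' + ω * (‖x + z‖ ^ 2 : ℝ)) ^ (-((n / 2 - s : ℝ) : ℂ))
        - (ω' + ω * (‖x - z‖ ^ 2 : ℝ)) ^ (-((n / 2 - s : ℝ) : ℂ))) *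
        ((‖z‖ ^ (-(n : ℝ) - 2 * s) : ℝ) : ℂ)) := by
    intro z
    rw [setIntegral_congr_fun measurableSet_Ioi
      (fun r hr => integral_gaussDiff_mul_heatWeight hp x z hr), integral_const_mul,
      integral_mul_const, integral_gaussDiff hβ hω hω',
      show -(n : ℝ) - 2 * s = -(2 * (n / 2 + s)) by ring]
    ring
  have hright : ∀ t ∈ Ioi (0 : ℝ), ∫ r in Ioi (0 : ℝ), ∫ z : Spc n,
      gaussDiff (n / 2 - s) ω ω' x z r * (heatWeight (n / 2 + s) ‖z‖ r t : ℂ)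
      = 2 * ((π ^ (n / 2 : ℝ) : ℝ) : ℂ) * Real.Gamma (n / 2) *
        (((t ^ (n / 2 + s - 1 : ℝ) : ℝ) : ℂ) *
        ((t * b) ^ (-((n / 2 : ℝ) : ℂ)) - (1 + t * b) ^ (-((n / 2 : ℝ) : ℂ)))) := by
    intro t ht
    have ht : 0 < t := ht
    have hw := re_moebius_pos hω hω' hωω' ht (sq_nonneg ‖x‖)
    rw [← hbdef] at hw
    have hre : 0 < ((t : ℂ) + ω).re := by
      rw [Complex.add_re, Complex.ofReal_re]; positivity
    have htω0 : ((t : ℂ) + ω) ≠ 0 := fun h => by simp [h] at hre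
    rw [setIntegral_congr_fun measurableSet_Ioi
      (fun r hr => integral_gaussDiff_mul_heatWeight_space hω hωω' hr ht x), integral_const_mul,
      ← hbdef, integral_sub ((integrableOn_rpow_mul_cexp hd hb).const_mul _)
        ((integrableOn_rpow_mul_cexp hd hw).const_mul _), integral_const_mul, integral_const_mul,
      integral_rpow_mul_cexp hd hb, integral_rpow_mul_cexp hd hw, ofReal_mul_cpow ht hb]
    have h := mul_cpow_of_re_pos hre hw (-((n / 2 : ℝ) : ℂ))
    rw [mul_div_cancel₀ _ htω0] at h
    rw [h]
    ring
  rw [integral_congr_ae (Eventually.of_forall hleft), setIntegral_congr_fun measurableSet_Ioi hright,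
    integral_const_mul, integral_const_mul, integral_rpow_mul_cpow_sub hd hs hs1 hb] at hrev
  have hG1 : ((Real.Gamma (n / 2 + s) : ℝ) : ℂ) ≠ 0 :=
    Complex.ofReal_ne_zero.2 (Real.Gamma_pos_of_pos hp).ne'
  have hG2 : ((Real.Gamma (n / 2 - s) : ℝ) : ℂ) ≠ 0 :=
    Complex.ofReal_ne_zero.2 (Real.Gamma_pos_of_pos hβ).ne'
  refine mul_left_cancel₀ (mul_ne_zero hG1 hG2) (hrev.trans ?_)
  have hc : Real.Gamma (n / 2 + s) * Real.Gamma (n / 2 - s) * bubConst (n / 2) s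
      = 2 * π ^ (n / 2 : ℝ) * Real.Gamma (n / 2) * kerConst (n / 2) s := by
    rw [mul_comm (Real.Gamma (n / 2 + s)), bubConst]
    exact mul_div_cancel₀ _ (mul_pos (Real.Gamma_pos_of_pos hβ) (Real.Gamma_pos_of_pos hp)).ne'
  have hc' := congrArg (fun y : ℝ => (y : ℂ)) hc
  simp only [Complex.ofReal_mul, Complex.ofReal_ofNat] at hc'
  rw [← mul_assoc, ← hc', mul_assoc]

lemma min_one_sq_le_rpow {y σ : ℝ} (hy : 0 ≤ y) (hσ : 0 ≤ σ) (hσ2 : σ ≤ 2) :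
    min 1 (y ^ 2) ≤ y ^ σ := by
  rcases le_total 1 y with h | h
  · exact (min_le_left _ _).trans (one_le_rpow h hσ)
  · rcases hy.eq_or_lt with rfl | h0
    · refine (min_le_right _ _).trans ?_
      rw [zero_pow two_ne_zero]
      exact rpow_nonneg le_rfl _
    · refine (min_le_right _ _).trans ?_
      rw [← rpow_two]
      exact rpow_le_rpow_of_exponent_ge h0 h hσ2

lemma norm_bub_cpow_le {γ u θ : ℝ} (hγ : 0 ≤ γ) (hθ : θ ∈ angles) (hu : 0 ≤ u) :
    ‖bub θ u ^ (-γ : ℂ)‖ ≤ (cos θ * (1 + u)) ^ (-γ) := by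
  have hc := cos_pos_angles hθ
  rw [← Complex.ofReal_neg, Complex.norm_cpow_real]
  exact rpow_le_rpow_of_nonpos (by positivity) (cos_mul_le_norm_bub θ u) (by linarith)

lemma norm_bub_cpow_le_cos {γ u θ : ℝ} (hγ : 0 ≤ γ) (hθ : θ ∈ angles) (hu : 0 ≤ u) :
    ‖bub θ u ^ (-γ : ℂ)‖ ≤ cos θ ^ (-γ) := by
  have hc := cos_pos_angles hθ
  refine (norm_bub_cpow_le hγ hθ hu).trans ?_
  exact rpow_le_rpow_of_nonpos hc (by nlinarith) (by linarith)

lemma norm_bub_second_difference_le_sq {E : Type*} [NormedAddCommGroup E] [InnerProductSpace ℝ E]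
    {β θ : ℝ} (hβ : 0 < β) (hθ : θ ∈ angles) (x z : E) :
    ‖2 * bub θ (‖x‖ ^ 2) ^ (-β : ℂ) - bub θ (‖x + z‖ ^ 2) ^ (-β : ℂ)
      - bub θ (‖x - z‖ ^ 2) ^ (-β : ℂ)‖
      ≤ 2 * ((4 * (β * (β + 1)) + 2 * β) * cos θ ^ (-(β + 2))) * ‖z‖ ^ 2 := by
  have hc := cos_pos_angles hθ
  have hc1 := cos_le_one θ
  have hexp : ‖Complex.exp (θ * Complex.I)‖ = 1 := Complex.norm_exp_ofReal_mul_I θ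
  refine norm_radial_second_difference_le (f := fun u => bub θ u ^ (-β : ℂ))
    (f' := fun u => -β * bub θ u ^ (-(β + 1 : ℝ) : ℂ) * Complex.exp (θ * Complex.I))
    (f'' := fun u => -β * (-(β + 1 : ℝ) * bub θ u ^ (-(β + 2 : ℝ) : ℂ) *
      Complex.exp (θ * Complex.I)) * Complex.exp (θ * Complex.I)) ?_ ?_ ?_ x z
  · intro u hu
    have := hasDerivAt_bub_cpow (γ := -β) (bub_mem_slitPlane hθ (show -1 < u by linarith))
    convert this using 3
    push_cast
    ring_nf
  · intro u hu
    have := hasDerivAt_bub_cpow (γ := -(β + 1 : ℝ)) (bub_mem_slitPlane hθ (show -1 < u by linarith))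
    have e : (-(β + 1 : ℝ) - 1 : ℂ) = -(β + 2 : ℝ) := by push_cast; ring
    rw [e] at this
    exact (this.const_mul (-β : ℂ)).mul_const (Complex.exp (θ * Complex.I))
  · intro u hu
    have h2 := norm_bub_cpow_le (γ := β + 2) (by linarith) hθ hu
    have h1 := norm_bub_cpow_le_cos (γ := β + 1) (by linarith) hθ hu
    have h1' : cos θ ^ (-(β + 1)) ≤ cos θ ^ (-(β + 2)) :=
      rpow_le_rpow_of_exponent_ge hc hc1 (by linarith)
    have h2' : u * (cos θ * (1 + u)) ^ (-(β + 2)) ≤ cos θ ^ (-(β + 2)) := by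
      rw [mul_rpow hc.le (by linarith), mul_left_comm]
      refine mul_le_of_le_one_right (by positivity) ?_
      rw [rpow_neg (by linarith), ← div_eq_mul_inv, div_le_one (by positivity)]
      calc u ≤ (1 + u) ^ (1 : ℝ) := by rw [rpow_one]; linarith
        _ ≤ _ := rpow_le_rpow_of_exponent_le (by linarith) (by linarith)
    have n1 : ‖(-β : ℂ)‖ = β := by
      rw [norm_neg, Complex.norm_real, Real.norm_of_nonneg hβ.le]
    have n2 : ‖(-(β + 1 : ℝ) : ℂ)‖ = β + 1 := by
      rw [norm_neg, Complex.norm_real, Real.norm_of_nonneg (by linarith)]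
    simp only [norm_mul, hexp, n1, n2, mul_one]
    have h3 := mul_le_mul_of_nonneg_left h2 hu
    have h4 : β * (β + 1) * (u * ‖bub θ u ^ (-(β + 2 : ℝ) : ℂ)‖)
        ≤ β * (β + 1) * cos θ ^ (-(β + 2)) :=
      mul_le_mul_of_nonneg_left (h3.trans h2') (by positivity)
    have h5 := mul_le_mul_of_nonneg_left (h1.trans h1') hβ.le
    linarith

lemma norm_bub_second_difference_le {E : Type*} [NormedAddCommGroup E] [InnerProductSpace ℝ E]
    {β σ θ : ℝ} (hβ : 0 < β) (hσ : 0 ≤ σ) (hσ2 : σ ≤ 2) (hθ : θ ∈ angles) (x z : E) :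
    ‖2 * bub θ (‖x‖ ^ 2) ^ (-β : ℂ) - bub θ (‖x + z‖ ^ 2) ^ (-β : ℂ)
      - bub θ (‖x - z‖ ^ 2) ^ (-β : ℂ)‖
      ≤ (4 + 2 * (4 * (β * (β + 1)) + 2 * β)) * cos θ ^ (-(β + σ)) * min 1 (‖z‖ ^ σ) := by
  have hc := cos_pos_angles hθ
  have hc1 := cos_le_one θ
  have hA := norm_bub_second_difference_le_sq hβ hθ x z
  have hB : ‖2 * bub θ (‖x‖ ^ 2) ^ (-β : ℂ) - bub θ (‖x + z‖ ^ 2) ^ (-β : ℂ)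
      - bub θ (‖x - z‖ ^ 2) ^ (-β : ℂ)‖ ≤ 4 * cos θ ^ (-β) := by
    have h0 := norm_bub_cpow_le_cos hβ.le hθ (sq_nonneg ‖x‖)
    have h1 := norm_bub_cpow_le_cos hβ.le hθ (sq_nonneg ‖x + z‖)
    have h2 := norm_bub_cpow_le_cos hβ.le hθ (sq_nonneg ‖x - z‖)
    refine (norm_sub_le _ _).trans ?_
    have := norm_sub_le (2 * bub θ (‖x‖ ^ 2) ^ (-β : ℂ)) (bub θ (‖x + z‖ ^ 2) ^ (-β : ℂ))
    rw [norm_mul, Complex.norm_ofNat] at this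
    linarith
  set D := ‖2 * bub θ (‖x‖ ^ 2) ^ (-β : ℂ) - bub θ (‖x + z‖ ^ 2) ^ (-β : ℂ)
      - bub θ (‖x - z‖ ^ 2) ^ (-β : ℂ)‖
  set K := 2 * (4 * (β * (β + 1)) + 2 * β) with hK
  have hK0 : 0 ≤ K := by positivity
  have hD : D ≤ (4 + K) * cos θ ^ (-β) * min 1 ((‖z‖ / cos θ) ^ 2) := by
    have e : cos θ ^ (-(β + 2)) = cos θ ^ (-β) / cos θ ^ 2 := by
      rw [← rpow_two, ← rpow_sub hc]; congr 1; ring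
    rw [e] at hA
    rcases le_total 1 ((‖z‖ / cos θ) ^ 2) with h | h
    · rw [min_eq_left h]
      have : 0 ≤ K * cos θ ^ (-β) := by positivity
      linarith
    · rw [min_eq_right h, div_pow]
      have h4 : 0 ≤ 4 * cos θ ^ (-β) * (‖z‖ ^ 2 / cos θ ^ 2) := by positivity
      calc D ≤ _ := hA
        _ = K * cos θ ^ (-β) * (‖z‖ ^ 2 / cos θ ^ 2) := by rw [hK]; ring
        _ ≤ _ := by linarith
  refine hD.trans ?_
  have e : cos θ ^ (-(β + σ)) = cos θ ^ (-β) * (cos θ ^ σ)⁻¹ := by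
    rw [← rpow_neg hc.le, ← rpow_add hc]; congr 1; ring
  rw [e, mul_assoc _ _ (min 1 (‖z‖ ^ σ)), mul_assoc (cos θ ^ (-β)), ← mul_assoc (4 + K)]
  refine mul_le_mul_of_nonneg_left ?_ (by positivity)
  rw [mul_min_of_nonneg _ _ (by positivity), mul_one]
  refine le_min ?_ ?_
  · exact (min_le_left _ _).trans ((one_le_inv₀ (by positivity)).2 (rpow_le_one hc.le hc1 hσ))
  · refine (min_one_sq_le_rpow (by positivity) hσ hσ2).trans (le_of_eq ?_)
    rw [div_rpow (norm_nonneg _) hc.le]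
    ring

/-- Second difference of the integrand of `bubInt` composed with the squared norm, weighted by the
kernel of the fractional Laplacian. -/
def bubKer {n : ℕ} (m s : ℝ) (x z : Spc n) (θ : ℝ) : ℂ :=
  (2 * bubFun (n / 2) m (n / 2 - s) (‖x‖ ^ 2) θ - bubFun (n / 2) m (n / 2 - s) (‖x + z‖ ^ 2) θ
    - bubFun (n / 2) m (n / 2 - s) (‖x - z‖ ^ 2) θ) * ((‖z‖ ^ (-(n : ℝ) - 2 * s) : ℝ) : ℂ)

lemma bubKer_eq {n : ℕ} (m s : ℝ) (x z : Spc n) (θ : ℝ) :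
    bubKer m s x z θ = (((2 * cos θ) ^ (n / 2 : ℝ) : ℝ) : ℂ) * Complex.exp (m * θ * Complex.I) *
      ((2 * bub θ (‖x‖ ^ 2) ^ (-((n / 2 - s : ℝ) : ℂ)) - bub θ (‖x + z‖ ^ 2) ^ (-((n / 2 - s : ℝ) : ℂ))
      - bub θ (‖x - z‖ ^ 2) ^ (-((n / 2 - s : ℝ) : ℂ))) * ((‖z‖ ^ (-(n : ℝ) - 2 * s) : ℝ) : ℂ)) := by
  unfold bubKer bubFun
  ring

lemma measurable_bubKer {n : ℕ} (m s : ℝ) (x : Spc n) :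
    Measurable (fun q : Spc n × ℝ => bubKer m s x q.1 q.2) := by
  unfold bubKer bubFun bub
  fun_prop

lemma integrable_bubKer {n : ℕ} {m s : ℝ} (hn : 1 ≤ n) (hs : 0 < s) (hs1 : s < 1)
    (hsn : s < n / 2) (x : Spc n) :
    Integrable (fun q : Spc n × ℝ => bubKer m s x q.1 q.2)
      ((volume : Measure (Spc n)).prod (volume.restrict angles)) := by
  set σ : ℝ := (1 + 3 * s) / 2 with hσ
  set K : ℝ := 4 + 2 * (4 * ((n / 2 - s) * (n / 2 - s + 1)) + 2 * (n / 2 - s))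
  have hb : Integrable (fun q : Spc n × ℝ =>
      (min 1 (‖q.1‖ ^ σ) * ‖q.1‖ ^ (-(n : ℝ) - 2 * s)) *
        (2 ^ (n / 2 : ℝ) * K * cos q.2 ^ (s - σ)))
      ((volume : Measure (Spc n)).prod (volume.restrict angles)) :=
    (integrable_min_norm_rpow hn hs (by linarith)).mul_prod
      ((integrableOn_cos_rpow (by linarith)).const_mul _)
  have hmem : ∀ᵐ q : Spc n × ℝ ∂((volume : Measure (Spc n)).prod (volume.restrict angles)),
      q.2 ∈ angles :=
    Measure.quasiMeasurePreserving_snd.ae (p := fun θ : ℝ => θ ∈ angles)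
      (ae_restrict_mem measurableSet_Ioo)
  refine hb.mono' (measurable_bubKer m s x).aestronglyMeasurable ?_
  filter_upwards [hmem] with q hq
  have hc := cos_pos_angles hq
  have h := norm_bub_second_difference_le (β := n / 2 - s) (σ := σ) (by linarith) (by linarith)
    (by linarith) hq x q.1
  have hk : 0 ≤ ‖q.1‖ ^ (-(n : ℝ) - 2 * s) := by positivity
  have he : ‖Complex.exp (m * q.2 * Complex.I)‖ = 1 := by
    rw [← Complex.ofReal_mul]; exact Complex.norm_exp_ofReal_mul_I _
  rw [bubKer_eq, norm_mul, norm_mul, norm_mul, he, Complex.norm_real, Complex.norm_real,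
    Real.norm_of_nonneg hk, Real.norm_of_nonneg (by positivity), mul_rpow zero_le_two hc.le]
  have e : cos q.2 ^ (s - σ) = cos q.2 ^ (n / 2 : ℝ) * cos q.2 ^ (-(n / 2 - s + σ)) := by
    rw [← rpow_add hc]; congr 1; ring
  rw [e]
  calc _ ≤ 2 ^ (n / 2 : ℝ) * cos q.2 ^ (n / 2 : ℝ) * 1 *
        (K * cos q.2 ^ (-(n / 2 - s + σ)) * min 1 (‖q.1‖ ^ σ) * ‖q.1‖ ^ (-(n : ℝ) - 2 * s)) := by
        gcongr
    _ = _ := by ring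

lemma integral_bubKer_angles {n : ℕ} {m s : ℝ} (hs : 0 < s) (hsn : s < n / 2) (x z : Spc n) :
    ∫ θ in angles, bubKer m s x z θ
      = (2 * bubInt (n / 2) m (n / 2 - s) (‖x‖ ^ 2) - bubInt (n / 2) m (n / 2 - s) (‖x + z‖ ^ 2)
    - bubInt (n / 2) m (n / 2 - s) (‖x - z‖ ^ 2)) * ((‖z‖ ^ (-(n : ℝ) - 2 * s) : ℝ) : ℂ) := by
  have hi : ∀ y : Spc n, IntegrableOn (bubFun (n / 2) m (n / 2 - s) (‖y‖ ^ 2)) angles := fun y =>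
    integrable_bubFun (by linarith) (by linarith) (by linarith [sq_nonneg ‖y‖])
  unfold bubKer
  rw [integral_mul_const, integral_sub_sub ((hi x).const_mul 2) (hi _) (hi _), integral_const_mul]
  rfl

lemma integral_bubKer_space {n : ℕ} {m s : ℝ} (hn : 1 ≤ n) (hs : 0 < s) (hs1 : s < 1)
    (hsn : s < n / 2) (x : Spc n) {θ : ℝ} (hθ : θ ∈ angles) :
    ∫ z : Spc n, bubKer m s x z θ
      = bubConst (n / 2) s * bubFun (n / 2) m (n / 2 + s) (‖x‖ ^ 2) θ := by
  have hc := cos_pos_angles hθ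
  have h := integral_bubble_second_difference (ω := Complex.exp (θ * Complex.I))
    (ω' := Complex.exp (-(θ * Complex.I))) hn hs hs1 hsn
    (by rw [Complex.exp_ofReal_mul_I_re]; exact hc) (Complex.norm_exp_ofReal_mul_I θ)
    (by rw [← neg_mul, ← Complex.ofReal_neg, Complex.exp_ofReal_mul_I_re, cos_neg]; exact hc)
    (by rw [← Complex.exp_add, add_neg_cancel, Complex.exp_zero]) x
  simp only [bubKer_eq]
  rw [integral_const_mul]
  refine (congrArg _ h).trans ?_
  rw [bubFun, bub]
  ring

lemma integral_bubInt_second_difference {n : ℕ} (m : ℝ) {s : ℝ} (hn : 1 ≤ n) (hs : 0 < s)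
    (hs1 : s < 1) (hsn : s < n / 2) (x : Spc n) :
    Integrable (fun z : Spc n =>
      (2 * bubInt (n / 2) m (n / 2 - s) (‖x‖ ^ 2) - bubInt (n / 2) m (n / 2 - s) (‖x + z‖ ^ 2)
      - bubInt (n / 2) m (n / 2 - s) (‖x - z‖ ^ 2)) * ((‖z‖ ^ (-(n : ℝ) - 2 * s) : ℝ) : ℂ)) ∧
    ∫ z : Spc n,
      (2 * bubInt (n / 2) m (n / 2 - s) (‖x‖ ^ 2) - bubInt (n / 2) m (n / 2 - s) (‖x + z‖ ^ 2)
      - bubInt (n / 2) m (n / 2 - s) (‖x - z‖ ^ 2)) * ((‖z‖ ^ (-(n : ℝ) - 2 * s) : ℝ) : ℂ)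
      = bubConst (n / 2) s * bubInt (n / 2) m (n / 2 + s) (‖x‖ ^ 2) := by
  have hI := integrable_bubKer (m := m) hn hs hs1 hsn x
  have hswap := integral_integral_swap (f := bubKer m s x) hI
  have hleft := hI.integral_prod_left
  simp only [integral_bubKer_angles hs hsn] at hswap hleft
  refine ⟨hleft, hswap.trans ?_⟩
  rw [setIntegral_congr_fun measurableSet_Ioo
    (fun θ hθ => integral_bubKer_space hn hs hs1 hsn x hθ), integral_const_mul]
  rfl

/-- The fractional Laplacian of the radial function with profile `prof`. -/
lemma Ls_prof {n : ℕ} {s : ℝ} (hn : 1 ≤ n) (hs : 0 < s) (hs1 : s < 1) (hsn : s < n / 2)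
    (x : Spc n) :
    Ls n s (fun y => prof (n / 2) s (‖y‖ ^ 2)) x
      = fracLapConst n s / 2 * (bubConst (n / 2) s * dens (n / 2) s (‖x‖ ^ 2)) := by
  obtain ⟨hi, h⟩ := integral_bubInt_second_difference (s - 2) hn hs hs1 hsn x
  have hre := integral_re hi
  rw [h] at hre
  rw [Ls]
  congr 1
  rw [dens, ← Complex.re_ofReal_mul]
  refine Eq.trans (integral_congr_ae (Eventually.of_forall fun z => ?_)) hre
  simp only [prof]
  rw [RCLike.re_eq_complex_re, mul_comm _ ((_ : ℝ) : ℂ), Complex.re_ofReal_mul, mul_comm]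
  simp

lemma fracLapConst_pos {n : ℕ} {s : ℝ} (hs : 0 < s) (hs1 : s < 1) : 0 < fracLapConst n s := by
  have h1 : 0 < Real.Gamma ((n : ℝ) / 2 + s) := Real.Gamma_pos_of_pos (by positivity)
  have h2 : Real.Gamma (-s) ≠ 0 := by
    refine Real.Gamma_ne_zero fun m hm => ?_
    have hm' : s = m := by linarith
    rw [hm'] at hs hs1
    have a1 : 0 < m := by exact_mod_cast hs
    have a2 : m < 1 := by exact_mod_cast hs1
    omega
  have h3 := abs_pos.2 h2
  unfold fracLapConst
  positivity

lemma dens_zero_nonneg {n : ℕ} {s : ℝ} (hn : 1 ≤ n) (hs : 0 < s) (hs1 : s < 1)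
    (hsn : s < n / 2) : 0 ≤ dens (n / 2) s 0 := by
  have h := Ls_prof hn hs hs1 hsn 0
  have hL : 0 ≤ Ls n s (fun y => prof (n / 2) s (‖y‖ ^ 2)) 0 := by
    refine mul_nonneg (by linarith [fracLapConst_pos (n := n) hs hs1]) (integral_nonneg fun z => ?_)
    refine mul_nonneg ?_ (by positivity)
    have hmono : ∀ y : Spc n, prof (n / 2) s (‖y‖ ^ 2) ≤ prof (n / 2) s (‖(0 : Spc n)‖ ^ 2) :=
      fun y => antitoneOn_prof hs hsn (mem_Ici.2 (sq_nonneg _)) (mem_Ici.2 (sq_nonneg _))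
        (by simp)
    have h1 := hmono (0 + z)
    have h2 := hmono (0 - z)
    linarith
  rw [h] at hL
  have h0 := fracLapConst_pos (n := n) hs hs1
  have h1 := bubConst_pos hs hs1 hsn
  rw [← mul_assoc] at hL
  simpa using nonneg_of_mul_nonneg_right hL (by positivity)

lemma hasGradientAt_radial {n : ℕ} {f : ℝ → ℝ} {f' : ℝ} {κ : ℝ} {x : Spc n}
    (h : HasDerivAt f f' (κ * ‖x‖ ^ 2)) :
    HasGradientAt (fun y : Spc n => f (κ * ‖y‖ ^ 2)) ((2 * κ * f') • x) x := by
  rw [hasGradientAt_iff_hasFDerivAt]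
  have h1 := ((hasStrictFDerivAt_norm_sq x).hasFDerivAt).const_mul κ
  refine (h.comp_hasFDerivAt x h1).congr_fderiv ?_
  ext y
  simp
  ring

lemma c1HolderGrad_prof {n : ℕ} {d s κ A : ℝ} (hs : 0 < s) (hs1 : s < 1) (hsd : s < d)
    (hκ : 0 ≤ κ) : C1HolderGrad n s (fun y : Spc n => A * prof d s (κ * ‖y‖ ^ 2)) := by
  have hpos : ∀ y : Spc n, 0 ≤ κ * ‖y‖ ^ 2 := fun y => by positivity
  have hgrad : ∀ y : Spc n, HasGradientAt (fun y : Spc n => A * prof d s (κ * ‖y‖ ^ 2))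
      ((2 * κ * (A * profD d s (κ * ‖y‖ ^ 2))) • y) y := fun y =>
    hasGradientAt_radial (f := fun u => A * prof d s u)
      ((hasDerivAt_prof hs hsd (by linarith [hpos y])).const_mul A)
  have hcont : Continuous (fun y : Spc n => profD d s (κ * ‖y‖ ^ 2)) := by
    refine continuous_iff_continuousAt.2 fun y => ?_
    exact ContinuousAt.comp (f := fun y : Spc n => κ * ‖y‖ ^ 2)
      (continuousAt_profD hs hsd (by linarith [hpos y])) (by fun_prop)
  constructor
  · rw [contDiff_one_iff_fderiv]
    refine ⟨fun y => (hgrad y).differentiableAt, ?_⟩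
    have e : fderiv ℝ (fun y : Spc n => A * prof d s (κ * ‖y‖ ^ 2)) =
        fun y => InnerProductSpace.toDual ℝ (Spc n)
          ((2 * κ * (A * profD d s (κ * ‖y‖ ^ 2))) • y) :=
      funext fun y => (hgrad y).hasFDerivAt.fderiv
    rw [e]
    fun_prop
  · intro K hK
    obtain ⟨R, hR0, hR⟩ := hK.isBounded.exists_pos_norm_le
    obtain ⟨M, hM0, hM⟩ := exists_abs_profD_sub_le hs hs1 hsd
    set B := |profD d s 0|
    refine ⟨|2 * κ * A| * (M * (κ * (2 * R)) ^ s * R + B * (2 * R) ^ (1 - s)), fun x hx y hy => ?_⟩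
    have hxR := hR x hx
    have hyR := hR y hy
    rw [(hgrad x).gradient, (hgrad y).gradient]
    have hxy : ‖x - y‖ ≤ 2 * R := (norm_sub_le x y).trans (by linarith)
    have h1 : |profD d s (κ * ‖x‖ ^ 2) - profD d s (κ * ‖y‖ ^ 2)|
        ≤ M * (κ * (2 * R)) ^ s * ‖x - y‖ ^ s := by
      refine (hM _ _ (hpos x) (hpos y)).trans ?_
      rw [mul_assoc, ← mul_rpow (by positivity) (norm_nonneg _)]
      refine mul_le_mul_of_nonneg_left (rpow_le_rpow (abs_nonneg _) ?_ hs.le) hM0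
      have h2 : κ * ‖x‖ ^ 2 - κ * ‖y‖ ^ 2 = κ * ((‖x‖ + ‖y‖) * (‖x‖ - ‖y‖)) := by ring
      rw [h2, abs_mul, abs_mul, abs_of_nonneg hκ, abs_of_nonneg (by positivity), mul_assoc]
      have := abs_norm_sub_norm_le x y
      gcongr
      linarith
    have h2 : |profD d s (κ * ‖y‖ ^ 2)| ≤ B := by
      have := profD_nonpos hs hsd (hpos y)
      have := profD_zero_le hs hsd (hpos y)
      exact abs_le_abs_of_nonpos (by assumption) (by assumption)
    have h3 : ‖x - y‖ ≤ (2 * R) ^ (1 - s) * ‖x - y‖ ^ s := by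
      rcases (norm_nonneg (x - y)).eq_or_lt with h | h
      · rw [← h]; positivity
      · calc ‖x - y‖ = ‖x - y‖ ^ (1 - s) * ‖x - y‖ ^ s := by
              rw [← rpow_add h, sub_add_cancel, rpow_one]
          _ ≤ _ := by
              gcongr
    have e : (2 * κ * (A * profD d s (κ * ‖x‖ ^ 2))) • x - (2 * κ * (A * profD d s (κ * ‖y‖ ^ 2))) • y
        = (2 * κ * A) • ((profD d s (κ * ‖x‖ ^ 2) - profD d s (κ * ‖y‖ ^ 2)) • x +
          profD d s (κ * ‖y‖ ^ 2) • (x - y)) := by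
      module
    rw [e, norm_smul, Real.norm_eq_abs, mul_assoc |2 * κ * A|]
    refine mul_le_mul_of_nonneg_left ((norm_add_le _ _).trans ?_) (abs_nonneg _)
    rw [norm_smul, norm_smul, Real.norm_eq_abs, Real.norm_eq_abs, add_mul]
    refine add_le_add ?_ ?_
    · calc _ ≤ M * (κ * (2 * R)) ^ s * ‖x - y‖ ^ s * R := by gcongr
        _ = _ := by ring
    · rw [mul_assoc]
      gcongr

lemma Ls_const_mul_comp_smul {n : ℕ} {s k : ℝ} (A : ℝ) (hk : 0 < k) (p : Spc n → ℝ) (x : Spc n) :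
    Ls n s (fun y => A * p (k • y)) x = A * k ^ (2 * s) * Ls n s p (k • x) := by
  have h := Measure.integral_comp_smul (volume : Measure (Spc n))
    (fun w : Spc n => (2 * p (k • x) - p (k • x + w) - p (k • x - w)) * ‖w‖ ^ (-(n : ℝ) - 2 * s)) k
  have e : ∀ z : Spc n, (2 * (A * p (k • x)) - A * p (k • (x + z)) - A * p (k • (x - z))) *
      ‖z‖ ^ (-(n : ℝ) - 2 * s) = A * k ^ ((n : ℝ) + 2 * s) *
      ((2 * p (k • x) - p (k • x + k • z) - p (k • x - k • z)) * ‖k • z‖ ^ (-(n : ℝ) - 2 * s)) := by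
    intro z
    have h1 : k ^ ((n : ℝ) + 2 * s) * k ^ (-(n : ℝ) - 2 * s) = 1 := by
      rw [← rpow_add hk]
      simp
    rw [norm_smul, Real.norm_of_nonneg hk.le, mul_rpow hk.le (norm_nonneg _), smul_add, smul_sub]
    linear_combination (-(A * (2 * p (k • x) - p (k • x + k • z) - p (k • x - k • z)) *
      ‖z‖ ^ (-(n : ℝ) - 2 * s))) * h1
  have hk' : k ^ ((n : ℝ) + 2 * s) * (k ^ n)⁻¹ = k ^ (2 * s) := by
    rw [rpow_add hk, rpow_natCast]
    field_simp
  simp only [Ls, e]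
  rw [integral_const_mul, h, finrank_euclideanSpace_fin, abs_of_nonneg (by positivity), smul_eq_mul,
    ← hk']
  ring

lemma tendsto_prof_cocompact {n : ℕ} {d s κ : ℝ} (hs : 0 < s) (hsd : s < d) (hκ : 0 < κ) (A : ℝ) :
    Tendsto (fun y : Spc n => A * prof d s (κ * ‖y‖ ^ 2)) (cocompact (Spc n)) (nhds 0) := by
  have h := (((tendsto_prof hs hsd).comp (((tendsto_pow_atTop two_ne_zero).comp
    (tendsto_norm_cocompact_atTop (E := Spc n))).const_mul_atTop hκ)).const_mul A)
  rw [mul_zero] at h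
  exact h

lemma C1HolderGrad.exists_abs_second_difference_le {n : ℕ} {s : ℝ} {P : Spc n → ℝ} (hs : 0 < s)
    (hP : C1HolderGrad n s P) (x : Spc n) :
    ∃ M, 0 ≤ M ∧ ∀ z : Spc n, ‖z‖ ≤ 1 →
      |2 * P x - P (x + z) - P (x - z)| ≤ M * ‖z‖ ^ (1 + s) := by
  obtain ⟨hC, hH⟩ := hP
  obtain ⟨M, hM⟩ := hH _ (isCompact_closedBall x 1)
  refine ⟨|M| * 2 ^ s, by positivity, fun z hz => ?_⟩
  have hmem : ∀ τ ∈ Icc (0 : ℝ) 1, ‖τ • z‖ ≤ 1 := by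
    intro τ hτ
    rw [norm_smul, Real.norm_of_nonneg hτ.1]
    exact mul_le_one₀ hτ.2 (norm_nonneg _) hz
  have hg : ∀ y, HasFDerivAt P (InnerProductSpace.toDual ℝ (Spc n) (gradient P y)) y := fun y =>
    ((hC.differentiable one_ne_zero y).hasGradientAt).hasFDerivAt
  have hder : ∀ τ : ℝ, HasDerivAt (fun τ : ℝ => P (x + τ • z) + P (x - τ • z))
      (⟪gradient P (x + τ • z) - gradient P (x - τ • z), z⟫) τ := by
    intro τ
    have hl : HasDerivAt (fun τ : ℝ => τ • z) z τ := by
      simpa using (hasDerivAt_id τ).smul_const z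
    have h1 := (hg (x + τ • z)).comp_hasDerivAt τ (hl.const_add x)
    have h2 := (hg (x - τ • z)).comp_hasDerivAt τ (hl.const_sub x)
    refine (h1.add h2).congr_deriv ?_
    rw [map_neg, InnerProductSpace.toDual_apply_apply, InnerProductSpace.toDual_apply_apply,
      inner_sub_left]
    ring
  have hbound : ∀ τ ∈ Ico (0 : ℝ) 1,
      ‖(⟪gradient P (x + τ • z) - gradient P (x - τ • z), z⟫ : ℝ)‖
        ≤ |M| * 2 ^ s * ‖z‖ ^ (1 + s) := by
    intro τ hτ
    have hτz := hmem τ ⟨hτ.1, hτ.2.le⟩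
    have h1 := hM (x + τ • z) (by simpa using hτz) (x - τ • z)
      (by rw [mem_closedBall_iff_norm]; simpa using hτz)
    have h2 : ‖(x + τ • z) - (x - τ • z)‖ ≤ 2 * ‖z‖ := by
      rw [show (x + τ • z) - (x - τ • z) = (2 * τ) • z by module, norm_smul,
        Real.norm_of_nonneg (by linarith [hτ.1])]
      nlinarith [hτ.2, norm_nonneg z]
    refine (norm_inner_le_norm _ _).trans ?_
    calc _ ≤ (|M| * (2 * ‖z‖) ^ s) * ‖z‖ := by
          refine mul_le_mul_of_nonneg_right (h1.trans ?_) (norm_nonneg _)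
          exact mul_le_mul (le_abs_self M) (rpow_le_rpow (norm_nonneg _) h2 hs.le)
            (by positivity) (abs_nonneg _)
      _ = _ := by
          rw [mul_rpow zero_le_two (norm_nonneg _), rpow_add_of_nonneg (norm_nonneg _) zero_le_one
            hs.le, rpow_one]
          ring
  have h := norm_image_sub_le_of_norm_deriv_le_segment_01'
    (fun τ _ => (hder τ).hasDerivWithinAt) hbound
  simp only [one_smul, zero_smul, add_zero, sub_zero, Real.norm_eq_abs] at h
  rw [← abs_neg]
  convert h using 2
  ring

lemma exists_abs_le_of_tendsto_cocompact {n : ℕ} {P : Spc n → ℝ} (hc : Continuous P)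
    (h0 : Tendsto P (cocompact (Spc n)) (nhds 0)) : ∃ B, ∀ y, |P y| ≤ B := by
  have h1 : Tendsto (fun y => |P y|) (cocompact (Spc n)) (nhds 0) := by
    simpa using h0.abs
  have h2 : ∀ᶠ y in cocompact (Spc n), |P y| ≤ 1 := h1.eventually (ge_mem_nhds zero_lt_one)
  obtain ⟨K, hK, hK'⟩ := mem_cocompact.1 h2
  obtain ⟨B, hB⟩ := hK.exists_bound_of_continuousOn hc.continuousOn
  refine ⟨max B 1, fun y => ?_⟩
  by_cases hy : y ∈ K
  · exact (hB y hy).trans (le_max_left _ _)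
  · exact (hK' hy).trans (le_max_right _ _)

lemma C1HolderGrad.integrable_Ls {n : ℕ} {s : ℝ} {P : Spc n → ℝ} (hn : 1 ≤ n) (hs : 0 < s)
    (hs1 : s < 1) (hP : C1HolderGrad n s P) (h0 : Tendsto P (cocompact (Spc n)) (nhds 0))
    (x : Spc n) :
    Integrable (fun z : Spc n => (2 * P x - P (x + z) - P (x - z)) * ‖z‖ ^ (-(n : ℝ) - 2 * s)) := by
  have hc := hP.1.continuous
  obtain ⟨B, hB⟩ := exists_abs_le_of_tendsto_cocompact hc h0
  obtain ⟨M, hM0, hM⟩ := hP.exists_abs_second_difference_le hs x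
  have hB0 : 0 ≤ B := (abs_nonneg _).trans (hB x)
  have hm : Measurable (fun z => 2 * P x - P (x + z) - P (x - z)) :=
    (by fun_prop : Continuous fun z => 2 * P x - P (x + z) - P (x - z)).measurable
  refine ((integrable_min_norm_rpow hn hs (σ := 1 + s) (by linarith)).const_mul
    (4 * B + M)).mono'
    (hm.mul (measurable_norm.pow_const _)).aestronglyMeasurable (Eventually.of_forall fun z => ?_)
  have hk : 0 ≤ ‖z‖ ^ (-(n : ℝ) - 2 * s) := by positivity
  rw [norm_mul, Real.norm_eq_abs, Real.norm_of_nonneg hk, ← mul_assoc]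
  refine mul_le_mul_of_nonneg_right ?_ hk
  rcases le_total ‖z‖ 1 with hz | hz
  · rw [min_eq_right (rpow_le_one (norm_nonneg _) hz (by linarith))]
    refine (hM z hz).trans (mul_le_mul_of_nonneg_right (by linarith) (by positivity))
  · rw [min_eq_left (one_le_rpow hz (by linarith)), mul_one]
    have h1 := abs_le.1 (hB x)
    have h2 := abs_le.1 (hB (x + z))
    have h3 := abs_le.1 (hB (x - z))
    rw [abs_le]
    constructor <;> linarith [h1.1, h1.2, h2.1, h2.2, h3.1, h3.2]

lemma IsObstacleSol.le {n : ℕ} {s C a : ℝ} {P Q : Spc n → ℝ} (hn : 1 ≤ n) (hs : 0 < s)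
    (hs1 : s < 1) (hP : IsObstacleSol n s C a P) (hQ : IsObstacleSol n s C a Q) (x : Spc n) :
    P x ≤ Q x := by
  have : Nonempty (Fin n) := ⟨⟨0, hn⟩⟩
  obtain ⟨hP1, hP2, -, -, -, hP6⟩ := hP
  obtain ⟨hQ1, hQ2, hQ3, -, hQ5, -⟩ := hQ
  by_contra! hx
  have hw0 : Tendsto (fun y => P y - Q y) (cocompact (Spc n)) (nhds 0) := by
    simpa using hP2.sub hQ2
  have hwc : Continuous (fun y => P y - Q y) := hP1.1.continuous.sub hQ1.1.continuous
  obtain ⟨x₀, hx₀⟩ := hwc.exists_forall_ge' x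
    ((hw0.eventually (ge_mem_nhds (sub_pos.2 hx))))
  have hpos : 0 < P x₀ - Q x₀ := (sub_pos.2 hx).trans_le (hx₀ x)
  have hLP : Ls n s P x₀ = 0 := (hP6 x₀).resolve_left fun h => by linarith [hQ3 x₀]
  have hLQ := hQ5 x₀
  set D : Spc n → ℝ := fun z => 2 * (P x₀ - Q x₀) - (P (x₀ + z) - Q (x₀ + z))
    - (P (x₀ - z) - Q (x₀ - z)) with hD
  have hiP := hP1.integrable_Ls hn hs hs1 hP2 x₀
  have hiQ := hQ1.integrable_Ls hn hs hs1 hQ2 x₀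
  have hsub := integral_sub hiP hiQ
  have hfun : ∀ z : Spc n, (2 * P x₀ - P (x₀ + z) - P (x₀ - z)) * ‖z‖ ^ (-(n : ℝ) - 2 * s) -
      (2 * Q x₀ - Q (x₀ + z) - Q (x₀ - z)) * ‖z‖ ^ (-(n : ℝ) - 2 * s)
      = D z * ‖z‖ ^ (-(n : ℝ) - 2 * s) := by
    intro z
    rw [hD]
    ring
  have hiD := hiP.sub hiQ
  have hiD' : Integrable (fun z : Spc n => D z * ‖z‖ ^ (-(n : ℝ) - 2 * s)) :=
    hiD.congr (Eventually.of_forall hfun)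
  simp only [hfun] at hsub
  have hDnn : ∀ z, 0 ≤ D z := fun z => by
    have h1 := hx₀ (x₀ + z)
    have h2 := hx₀ (x₀ - z)
    simp only [hD]
    linarith
  have hnn : 0 ≤ fun z : Spc n => D z * ‖z‖ ^ (-(n : ℝ) - 2 * s) := fun z =>
    mul_nonneg (hDnn z) (by positivity)
  have hint : ∫ z : Spc n, D z * ‖z‖ ^ (-(n : ℝ) - 2 * s) = 0 := by
    refine le_antisymm ?_ (integral_nonneg hnn)
    have hc := fracLapConst_pos (n := n) hs hs1
    rw [Ls] at hLP hLQ
    have h1 := (mul_eq_zero.1 hLP).resolve_left (by positivity)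
    have h2 := nonneg_of_mul_nonneg_right hLQ (by positivity)
    rw [hsub, h1]
    linarith
  have hae := (integral_eq_zero_iff_of_nonneg hnn hiD').1 hint
  have hne : ∀ᵐ z : Spc n, z ≠ 0 := by
    rw [ae_iff]; simp
  have hDae : D =ᵐ[volume] fun _ => 0 := by
    filter_upwards [hae, hne] with z hz hz0
    exact (mul_eq_zero.1 hz).resolve_right (rpow_pos_of_pos (norm_pos_iff.2 hz0) _).ne'
  have hDc : Continuous D := by
    have := hP1.1.continuous
    have := hQ1.1.continuous
    fun_prop
  have hD0 : D = fun _ => 0 := (Continuous.ae_eq_iff_eq volume hDc continuous_const).1 hDae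
  have h1 := hw0.comp (Homeomorph.addLeft x₀).isClosedEmbedding.tendsto_cocompact
  have h2 := hw0.comp (Homeomorph.subLeft x₀).isClosedEmbedding.tendsto_cocompact
  have hlim : Tendsto D (cocompact (Spc n)) (nhds (2 * (P x₀ - Q x₀) - 0 - 0)) :=
    (tendsto_const_nhds.sub h1).sub h2
  rw [hD0] at hlim
  have := tendsto_nhds_unique hlim tendsto_const_nhds
  linarith

/-- The explicit solution of the obstacle problem, a rescaling of `prof`. -/
lemma exists_explicit_obstacleSol {n : ℕ} {s C a : ℝ} (hn : 1 ≤ n) (hs : 0 < s) (hs1 : s < 1)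
    (hns : 2 * s < n) (hC : 0 < C) (ha : 0 < a) :
    ∃ (P : Spc n → ℝ) (c k : ℝ), 0 ≤ c ∧ 0 < k ∧ IsObstacleSol n s C a P ∧
      (∀ x y : Spc n, ‖x‖ = ‖y‖ → P x = P y) ∧
      ∀ x, Ls n s P x = c * (max (1 - (k * ‖x‖) ^ 2) 0) ^ (1 - s) := by
  have hsn : s < n / 2 := by linarith
  have hp0 := prof_zero_pos hs hsn
  have hd0 := profD_zero_neg hs hsn
  set p0 := prof (n / 2) s 0
  set D := profD (n / 2) s 0
  set A := C / p0 with hA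
  have hA0 : 0 < A := div_pos hC hp0
  set k := √(a / (A * -D)) with hk
  have hAD : 0 < A * -D := mul_pos hA0 (neg_pos.2 hd0)
  have hk0 : 0 < k := sqrt_pos.2 (div_pos ha hAD)
  have hk2 : A * (D * k ^ 2) = -a := by
    have : (A * -D) * k ^ 2 = a := by
      rw [hk, sq_sqrt (div_pos ha hAD).le, mul_div_cancel₀ _ hAD.ne']
    linarith
  have hAp : A * p0 = C := div_mul_cancel₀ _ hp0.ne'
  set P : Spc n → ℝ := fun y => A * prof (n / 2) s (k ^ 2 * ‖y‖ ^ 2) with hP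
  set c := A * k ^ (2 * s) * (fracLapConst n s / 2 * (bubConst (n / 2) s * dens (n / 2) s 0)) with hc
  have hc0 : 0 ≤ c := by
    have := fracLapConst_pos (n := n) hs hs1
    have := bubConst_pos hs hs1 hsn
    have := dens_zero_nonneg hn hs hs1 hsn
    positivity
  have hL : ∀ x, Ls n s P x = c * (max (1 - (k * ‖x‖) ^ 2) 0) ^ (1 - s) := by
    intro x
    have e : P = fun y => A * (fun w : Spc n => prof (n / 2) s (‖w‖ ^ 2)) (k • y) := by
      funext y
      simp only [hP, norm_smul, mul_pow, Real.norm_eq_abs, sq_abs]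
    rw [e, Ls_const_mul_comp_smul A hk0 (fun w : Spc n => prof (n / 2) s (‖w‖ ^ 2)) x,
      Ls_prof hn hs hs1 hsn,
      dens_eq (by positivity) hs.le hs1 (by positivity) (sq_nonneg _), norm_smul,
      Real.norm_of_nonneg hk0.le, hc]
    ring
  refine ⟨P, c, k, hc0, hk0, ⟨c1HolderGrad_prof hs hs1 hsn (sq_nonneg k),
    tendsto_prof_cocompact hs hsn (by positivity) A, ?_, ?_, ?_, ?_⟩, ?_, hL⟩
  · intro y
    have h := mul_le_mul_of_nonneg_left
      (le_prof hs hsn (show 0 ≤ k ^ 2 * ‖y‖ ^ 2 by positivity)) hA0.le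
    calc C - a * ‖y‖ ^ 2 = A * (p0 + D * (k ^ 2 * ‖y‖ ^ 2)) := by
          linear_combination -hAp - ‖y‖ ^ 2 * hk2
      _ ≤ _ := h
  · rw [show Ls n s P = _ from funext hL]
    exact continuous_const.mul (Continuous.rpow_const (by fun_prop) fun x => Or.inr (by linarith))
  · intro y
    rw [hL]
    positivity
  · intro y
    rcases le_total (k ^ 2 * ‖y‖ ^ 2) 1 with h | h
    · left
      rw [hP]
      simp only
      rw [prof_of_le_one hs hsn (by positivity) h]
      linear_combination hAp + ‖y‖ ^ 2 * hk2
    · right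
      rw [hL, mul_pow, max_eq_right (by linarith), zero_rpow (by linarith), mul_zero]
  · intro x y hxy
    simp only [hP, hxy]

lemma abs_max_one_sub_sq_sub_le {r r' : ℝ} (hr : 0 ≤ r) (hr' : 0 ≤ r') :
    |max (1 - r ^ 2) 0 - max (1 - r' ^ 2) 0| ≤ 2 * |r - r'| := by
  have key : ∀ t : ℝ, 0 ≤ t → max (1 - t ^ 2) 0 = 1 - (min t 1) ^ 2 := by
    intro t ht
    rcases le_total t 1 with h | h
    · rw [min_eq_left h, max_eq_left (by nlinarith)]
    · rw [min_eq_right h, max_eq_right (by nlinarith)]; norm_num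
  rw [key r hr, key r' hr']
  have h1 : |min r 1 - min r' 1| ≤ |r - r'| := by
    simpa using abs_min_sub_min_le_max r 1 r' 1
  have h2 : 0 ≤ min r 1 := le_min hr zero_le_one
  have h3 : 0 ≤ min r' 1 := le_min hr' zero_le_one
  have h4 : |min r 1 + min r' 1| ≤ 2 := by
    rw [abs_of_nonneg (by linarith)]
    linarith [min_le_right r 1, min_le_right r' 1]
  calc _ = |min r 1 + min r' 1| * |min r 1 - min r' 1| := by
        rw [← abs_mul, ← abs_neg]; congr 1; ring
    _ ≤ _ := mul_le_mul h4 h1 (abs_nonneg _) zero_le_two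

lemma abs_rpow_sub_rpow_le {x y p : ℝ} (hx : 0 ≤ x) (hy : 0 ≤ y) (hp : 0 ≤ p) (hp1 : p ≤ 1) :
    |x ^ p - y ^ p| ≤ |x - y| ^ p := by
  rcases le_total x y with h | h
  · rw [abs_sub_comm, abs_sub_comm x, abs_of_nonneg (sub_nonneg.2 (rpow_le_rpow hx h hp)),
      abs_of_nonneg (sub_nonneg.2 h)]
    exact rpow_sub_rpow_le hx h hp hp1
  · rw [abs_of_nonneg (sub_nonneg.2 (rpow_le_rpow hy h hp)), abs_of_nonneg (sub_nonneg.2 h)]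
    exact rpow_sub_rpow_le hy h hp hp1

lemma abs_rpow_max_sub_le {n : ℕ} {k p : ℝ} (hk : 0 ≤ k) (hp : 0 ≤ p) (hp1 : p ≤ 1) (x y : Spc n) :
    |(max (1 - (k * ‖x‖) ^ 2) 0) ^ p - (max (1 - (k * ‖y‖) ^ 2) 0) ^ p|
      ≤ (2 * k) ^ p * ‖x - y‖ ^ p := by
  refine (abs_rpow_sub_rpow_le (le_max_right _ _) (le_max_right _ _) hp hp1).trans ?_
  rw [← mul_rpow (by positivity) (norm_nonneg _)]
  refine rpow_le_rpow (abs_nonneg _) ?_ hp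
  refine (abs_max_one_sub_sq_sub_le (by positivity) (by positivity)).trans ?_
  rw [← mul_sub, abs_mul, abs_of_nonneg hk, mul_assoc]
  have := abs_norm_sub_norm_le x y
  gcongr

/-- Theorem 3.1, existence/uniqueness part. For every `C > 0` and
`a > 0` there is exactly one solution of the fractional obstacle problem with obstacle
`Φ(y) = C − a|y|²`; moreover every such solution `P` is radially symmetric, and
`V = L_s P` is `(1−s)`-Hölder continuous and compactly supported. -/
theorem obstacle_existence_uniqueness
    (n : ℕ) (s : ℝ) (hn : 1 ≤ n) (hs0 : 0 < s) (hs1 : s < 1) (hns : 2 * s < (n : ℝ))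
    (C a : ℝ) (hC : 0 < C) (ha : 0 < a) :
    (∃! P : Spc n → ℝ, IsObstacleSol n s C a P) ∧
    (∀ P : Spc n → ℝ, IsObstacleSol n s C a P →
      (∀ x y : Spc n, ‖x‖ = ‖y‖ → P x = P y) ∧
      (∃ M : ℝ, 0 ≤ M ∧ ∀ x y : Spc n,
        |Ls n s P x - Ls n s P y| ≤ M * ‖x - y‖ ^ (1 - s)) ∧
      HasCompactSupport (Ls n s P)) := by
  obtain ⟨P₀, c, k, hc, hk, hsol, hrad, hL⟩ := exists_explicit_obstacleSol hn hs0 hs1 hns hC ha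
  have huniq : ∀ P, IsObstacleSol n s C a P → P = P₀ := fun P hP =>
    funext fun x => le_antisymm (hP.le hn hs0 hs1 hsol x) (hsol.le hn hs0 hs1 hP x)
  refine ⟨⟨P₀, hsol, huniq⟩, fun P hP => ?_⟩
  rw [huniq P hP]
  refine ⟨hrad, ⟨c * (2 * k) ^ (1 - s), by positivity, fun x y => ?_⟩, ?_⟩
  · rw [hL, hL, ← mul_sub, abs_mul, abs_of_nonneg hc, mul_assoc]
    exact mul_le_mul_of_nonneg_left
      (abs_rpow_max_sub_le hk.le (by linarith) (by linarith) x y) hc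
  · refine HasCompactSupport.intro (isCompact_closedBall 0 k⁻¹) fun x hx => ?_
    have hx' : k⁻¹ < ‖x‖ := by simpa using hx
    have h1 : 1 < k * ‖x‖ := by
      rwa [inv_lt_iff_one_lt_mul₀' hk] at hx'
    rw [hL, max_eq_right (by nlinarith), zero_rpow (by linarith), mul_zero]
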